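/- Let g and ḡ be projectively equivalent metrics on U. Then for every t ∈ ℝ the operator K̂^{(t)} commutes with the Beltrami–Laplace operator Δ_g: for every smooth function f : U → ℝ one has Δ_g(K̂^{(t)} f) = K̂^{(t)}(Δ_g f) on U. -/

import Mathlib

open Matrix

noncomputable section

/-- Partial derivative in the `i`-th coordinate direction of a real-valued function on `ℝⁿ`. -/
def pd {n : ℕ} (i : Fin n) (f : (Fin n → ℝ) → ℝ) : (Fin n → ℝ) → ℝ :=
  fun x => fderiv ℝ f x (Pi.single i 1)

/-- Iterated partial derivatives along a list of coordinate directions. -/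
def iterPD {n : ℕ} : List (Fin n) → ((Fin n → ℝ) → ℝ) → ((Fin n → ℝ) → ℝ)
  | [], f => f
  | i :: l, f => pd i (iterPD l f)

/-- `g` is a (pseudo-Riemannian) metric on `U`: a smooth field of invertible symmetric
real `n×n` matrices. -/
structure IsMetricOn {n : ℕ} (U : Set (Fin n → ℝ))
    (g : (Fin n → ℝ) → Matrix (Fin n) (Fin n) ℝ) : Prop where
  smooth : ∀ i j : Fin n, ContDiffOn ℝ (⊤ : ℕ∞) (fun x => g x i j) U
  symm : ∀ x ∈ U, (g x).IsSymm
  nondeg : ∀ x ∈ U, IsUnit (g x).det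

/-- The Christoffel symbols `Γ^k_{ij}` of the metric `g`. -/
def Gamma {n : ℕ} (g : (Fin n → ℝ) → Matrix (Fin n) (Fin n) ℝ)
    (k i j : Fin n) (x : Fin n → ℝ) : ℝ :=
  (1/2) * ∑ ℓ, (g x)⁻¹ k ℓ *
    (pd i (fun y => g y ℓ j) x + pd j (fun y => g y ℓ i) x - pd ℓ (fun y => g y i j) x)

/-- An open interval of `ℝ` (possibly empty or unbounded): an open order-connected set. -/
def IsOpenInterval (I : Set ℝ) : Prop := IsOpen I ∧ I.OrdConnected

/-- `γ` is a `g`-geodesic defined on the open interval `I`, with values in `U`. -/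
structure IsGeodesicOn {n : ℕ} (U : Set (Fin n → ℝ))
    (g : (Fin n → ℝ) → Matrix (Fin n) (Fin n) ℝ)
    (γ : ℝ → (Fin n → ℝ)) (I : Set ℝ) : Prop where
  interval : IsOpenInterval I
  smooth : ∀ k : Fin n, ContDiffOn ℝ (⊤ : ℕ∞) (fun s => γ s k) I
  mem : ∀ t ∈ I, γ t ∈ U
  eqn : ∀ t ∈ I, ∀ k : Fin n,
    deriv (deriv fun s => γ s k) t
      + ∑ i, ∑ j, Gamma g k i j (γ t) * deriv (fun s => γ s i) t * deriv (fun s => γ s j) t = 0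

/-- `g` and `gbar` are projectively equivalent on `U`: every `g`-geodesic with nowhere
vanishing velocity becomes, after a smooth reparameterization (a diffeomorphism of open
intervals), a `gbar`-geodesic. -/
def ProjEquiv {n : ℕ} (U : Set (Fin n → ℝ))
    (g gbar : (Fin n → ℝ) → Matrix (Fin n) (Fin n) ℝ) : Prop :=
  ∀ (γ : ℝ → (Fin n → ℝ)) (I : Set ℝ), IsGeodesicOn U g γ I →
    (∀ t ∈ I, ∃ k, deriv (fun s => γ s k) t ≠ 0) →
    ∃ (φ : ℝ → ℝ) (J : Set ℝ), IsOpenInterval J ∧ ContDiffOn ℝ (⊤ : ℕ∞) φ J ∧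
      Set.InjOn φ J ∧ φ '' J = I ∧ (∀ t ∈ J, deriv φ t ≠ 0) ∧
      IsGeodesicOn U gbar (γ ∘ φ) J

/-- The (1,1)-tensor `L = |det gbar / det g|^{1/(n+1)} gbar⁻¹ g` built from `g` and `gbar`. -/
def Lfield {n : ℕ} (g gbar : (Fin n → ℝ) → Matrix (Fin n) (Fin n) ℝ)
    (x : Fin n → ℝ) : Matrix (Fin n) (Fin n) ℝ :=
  |(gbar x).det / (g x).det| ^ ((1 : ℝ)/((n : ℝ)+1)) • ((gbar x)⁻¹ * g x)

/-- The family `S(t) = adjugate (t·Id − L)`. -/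
def Sfield {n : ℕ} (g gbar : (Fin n → ℝ) → Matrix (Fin n) (Fin n) ℝ) (t : ℝ)
    (x : Fin n → ℝ) : Matrix (Fin n) (Fin n) ℝ :=
  (t • (1 : Matrix (Fin n) (Fin n) ℝ) - Lfield g gbar x).adjugate

/-- The second order operator associated (via Carter's quantization) to a field `A` of
symmetric matrices: `Â f = |det g|^{-1/2} ∑ᵢⱼ ∂ᵢ(|det g|^{1/2} Aⁱʲ ∂ⱼ f)`. -/
def assocOp {n : ℕ} (g A : (Fin n → ℝ) → Matrix (Fin n) (Fin n) ℝ)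
    (f : (Fin n → ℝ) → ℝ) (x : Fin n → ℝ) : ℝ :=
  |(g x).det| ^ (-(1 : ℝ)/2) * ∑ i, ∑ j,
    pd i (fun y => |(g y).det| ^ ((1 : ℝ)/2) * A y i j * pd j f y) x

/-- The operator `K̂^{(t)}`, associated to `A = S(t)·g⁻¹`. -/
def Khat {n : ℕ} (g gbar : (Fin n → ℝ) → Matrix (Fin n) (Fin n) ℝ) (t : ℝ)
    (f : (Fin n → ℝ) → ℝ) (x : Fin n → ℝ) : ℝ :=
  assocOp g (fun y => Sfield g gbar t y * (g y)⁻¹) f x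

/-- The Beltrami-Laplace operator of `g`, associated to `A = g⁻¹`. -/
def LaplaceOp {n : ℕ} (g : (Fin n → ℝ) → Matrix (Fin n) (Fin n) ℝ)
    (f : (Fin n → ℝ) → ℝ) (x : Fin n → ℝ) : ℝ :=
  assocOp g (fun y => (g y)⁻¹) f x

/-- `K` is a Killing tensor for `g` on `U`: the associated quadratic function is constant
along every `g`-geodesic. -/
def IsKillingTensorOn {n : ℕ} (U : Set (Fin n → ℝ))
    (g K : (Fin n → ℝ) → Matrix (Fin n) (Fin n) ℝ) : Prop :=
  ∀ (γ : ℝ → (Fin n → ℝ)) (I : Set ℝ), IsGeodesicOn U g γ I →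
    ∀ τ₁ ∈ I, ∀ τ₂ ∈ I,
      (∑ i, ∑ j, deriv (fun s => γ s i) τ₁ * K (γ τ₁) i j * deriv (fun s => γ s j) τ₁) =
      (∑ i, ∑ j, deriv (fun s => γ s i) τ₂ * K (γ τ₂) i j * deriv (fun s => γ s j) τ₂)

/-- The covariant derivative `∇_k T_{ij}` of a (0,2)-tensor field `T`. -/
def covDeriv2 {n : ℕ} (g T : (Fin n → ℝ) → Matrix (Fin n) (Fin n) ℝ)
    (k i j : Fin n) (x : Fin n → ℝ) : ℝ :=
  pd k (fun y => T y i j) x - (∑ s, Gamma g s k i x * T x s j)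
    - ∑ s, Gamma g s k j x * T x i s

/-- The Ricci curvature tensor `R_{ij}` of `g`. -/
def Ricci {n : ℕ} (g : (Fin n → ℝ) → Matrix (Fin n) (Fin n) ℝ)
    (i j : Fin n) (x : Fin n → ℝ) : ℝ :=
  (∑ ℓ, pd ℓ (fun y => Gamma g ℓ i j y) x) - (∑ ℓ, pd i (fun y => Gamma g ℓ ℓ j y) x)
    + ∑ ℓ, ∑ s, (Gamma g ℓ ℓ s x * Gamma g s i j x - Gamma g ℓ i s x * Gamma g s ℓ j x)

/-- A function vanishes up to order `k` at `p`: it and all its partial derivatives of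
order `≤ k` vanish at `p`. -/
def VanishUpTo {n : ℕ} (k : ℕ) (f : (Fin n → ℝ) → ℝ) (p : Fin n → ℝ) : Prop :=
  ∀ l : List (Fin n), l.length ≤ k → iterPD l f p = 0


/-- The plain (flat) second order operator `Â f = ∑ᵢⱼ ∂ᵢ(Aⁱʲ ∂ⱼ f)` associated to a
matrix field `A`. -/
def opPlain {n : ℕ} (A : (Fin n → ℝ) → Matrix (Fin n) (Fin n) ℝ)
    (f : (Fin n → ℝ) → ℝ) (x : Fin n → ℝ) : ℝ :=
  ∑ i, ∑ j, pd i (fun y => A y i j * pd j f y) x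

end

namespace DiffAlg

variable {ι R : Type*} [Fintype ι] [CommRing R] [Algebra ℝ R]

section Derivation

variable (δ : Derivation ℝ R R)

omit [Fintype ι] in
theorem map_vecMulVec (a b : ι → R) :
    (vecMulVec a b).map δ = vecMulVec (δ ∘ a) b + vecMulVec a (δ ∘ b) := by
  ext i j
  simp [vecMulVec_apply, Derivation.leibniz, mul_comm, add_comm]

theorem map_mul (A B : Matrix ι ι R) : (A * B).map δ = A.map δ * B + A * B.map δ := by
  ext i j
  simp only [map_apply, Matrix.add_apply, mul_apply, map_sum, Derivation.leibniz, smul_eq_mul,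
    ← Finset.sum_add_distrib]
  exact Finset.sum_congr rfl fun k _ => by ring

theorem comp_mulVec (A : Matrix ι ι R) (v : ι → R) :
    δ ∘ (A *ᵥ v) = A.map δ *ᵥ v + A *ᵥ (δ ∘ v) := by
  ext i
  simp only [Function.comp_apply, Pi.add_apply, mulVec, dotProduct, map_apply, map_sum,
    Derivation.leibniz, smul_eq_mul, ← Finset.sum_add_distrib]
  exact Finset.sum_congr rfl fun k _ => by ring

theorem apply_dotProduct (a b : ι → R) :
    δ (a ⬝ᵥ b) = (δ ∘ a) ⬝ᵥ b + a ⬝ᵥ (δ ∘ b) := by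
  simp only [dotProduct, map_sum, Derivation.leibniz, smul_eq_mul, ← Finset.sum_add_distrib,
    Function.comp_apply]
  exact Finset.sum_congr rfl fun k _ => by ring

theorem apply_prod {α : Type*} [DecidableEq α] (s : Finset α) (f : α → R) :
    δ (∏ i ∈ s, f i) = ∑ i ∈ s, (∏ j ∈ s.erase i, f j) * δ (f i) := by
  induction s using Finset.induction_on with
  | empty => simp
  | insert a s ha ih =>
    rw [Finset.prod_insert ha, Derivation.leibniz, ih, Finset.sum_insert ha,
      Finset.erase_insert ha, smul_eq_mul, smul_eq_mul, Finset.mul_sum, add_comm]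
    congr 1
    refine Finset.sum_congr rfl fun i hi => ?_
    rw [Finset.erase_insert_of_ne (by rintro rfl; exact ha hi),
      Finset.prod_insert (fun h => ha (Finset.mem_of_mem_erase h)), mul_assoc]

variable [DecidableEq ι]

omit [Fintype ι] in
theorem map_one' : (1 : Matrix ι ι R).map δ = 0 := by
  ext i j
  by_cases h : i = j <;> simp [h, one_apply]

theorem map_inv {A : Matrix ι ι R} (hA : IsUnit A.det) :
    A⁻¹.map δ = -(A⁻¹ * A.map δ * A⁻¹) := by
  have h := map_mul δ A⁻¹ A
  rw [nonsing_inv_mul A hA, map_one'] at h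
  have h2 : A⁻¹.map δ * A * A⁻¹ = A⁻¹.map δ := by
    rw [Matrix.mul_assoc, mul_nonsing_inv A hA, Matrix.mul_one]
  rw [← h2, eq_neg_of_add_eq_zero_left h.symm, Matrix.neg_mul]

/-- **Jacobi's formula** for the derivative of a determinant. -/
theorem apply_det (A : Matrix ι ι R) : δ A.det = trace (A.adjugate * A.map δ) := by
  have key : δ A.det = ∑ i, (A.updateCol i (fun k => δ (A k i))).det := by
    simp only [det_apply, map_sum]
    rw [Finset.sum_comm]
    refine Finset.sum_congr rfl fun σ _ => ?_
    rw [← Finset.smul_sum]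
    simp only [Units.smul_def, map_zsmul]
    congr 1
    rw [apply_prod]
    refine Finset.sum_congr rfl fun i _ => ?_
    rw [← Finset.mul_prod_erase Finset.univ _ (Finset.mem_univ i), mul_comm]
    congr 1
    · simp
    · refine Finset.prod_congr rfl fun j hj => ?_
      rw [updateCol_ne (Finset.ne_of_mem_erase hj)]
  rw [key, trace]
  refine Finset.sum_congr rfl fun i _ => ?_
  rw [← cramer_apply, cramer_eq_adjugate_mulVec]
  rfl

end Derivation

variable [DecidableEq ι]

section Connection

variable (d : ι → Derivation ℝ R R) (Γ : ι → Matrix ι ι R)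

/-- Covariant derivative of a vector field; `Γ k i j` is the symbol `Γ^i_{kj}`. -/
def covVec (k : ι) (v : ι → R) : ι → R := d k ∘ v + Γ k *ᵥ v

/-- Covariant derivative of a field of endomorphisms. -/
def covEnd (k : ι) (T : Matrix ι ι R) : Matrix ι ι R := T.map (d k) + Γ k * T - T * Γ k

/-- Divergence of a vector field. -/
def divVec (v : ι → R) : R := ∑ j, covVec d Γ j v j

/-- Divergence of a field of endomorphisms over its upper index. -/
def divEnd (T : Matrix ι ι R) : ι → R := fun i => ∑ j, covEnd d Γ j T j i

/-- The endomorphism `X ↦ ∇_X v`. -/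
def jac (v : ι → R) : Matrix ι ι R := of fun i k => covVec d Γ k v i

/-- Curvature endomorphisms of the connection. -/
def curv (i j : ι) : Matrix ι ι R :=
  (Γ j).map (d i) - (Γ i).map (d j) + Γ i * Γ j - Γ j * Γ i

/-- Ricci tensor of the connection, up to sign convention. -/
def ric : Matrix ι ι R := of fun i m => -∑ j, curv d Γ i j j m

/-- `Γ` is the Levi-Civita connection of `g` with respect to the commuting derivations `d`. -/
structure IsLeviCivita (g : Matrix ι ι R) : Prop where
  comm : ∀ i j x, d i (d j x) = d j (d i x)
  symm : g.IsSymm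
  nondeg : IsUnit g.det
  torsion : ∀ i j k, Γ i k j = Γ j k i
  compat : ∀ k, g.map (d k) = (Γ k)ᵀ * g + g * Γ k

variable {d Γ}

omit [DecidableEq ι] in
theorem comp_eq_covVec (k : ι) (v : ι → R) : d k ∘ v = covVec d Γ k v - Γ k *ᵥ v := by
  rw [covVec]; abel

theorem covEnd_mul (k : ι) (S T : Matrix ι ι R) :
    covEnd d Γ k (S * T) = covEnd d Γ k S * T + S * covEnd d Γ k T := by
  simp only [covEnd, map_mul]
  noncomm_ring

omit [DecidableEq ι] in
theorem covEnd_smul (k : ι) (a : R) (T : Matrix ι ι R) :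
    covEnd d Γ k (a • T) = d k a • T + a • covEnd d Γ k T := by
  have : (a • T).map (d k) = d k a • T + a • T.map (d k) := by
    ext i j; simp [Derivation.leibniz]; ring
  simp only [covEnd, this, Matrix.mul_smul, Matrix.smul_mul, smul_add, smul_sub]
  abel

theorem covEnd_add (k : ι) (S T : Matrix ι ι R) :
    covEnd d Γ k (S + T) = covEnd d Γ k S + covEnd d Γ k T := by
  have : (S + T).map (d k) = S.map (d k) + T.map (d k) := by ext i j; simp
  simp only [covEnd, this]
  noncomm_ring

theorem covEnd_one (k : ι) : covEnd d Γ k (1 : Matrix ι ι R) = 0 := by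
  simp [covEnd, map_one']

omit [DecidableEq ι] in
theorem covVec_mulVec (k : ι) (T : Matrix ι ι R) (v : ι → R) :
    covVec d Γ k (T *ᵥ v) = covEnd d Γ k T *ᵥ v + T *ᵥ covVec d Γ k v := by
  simp only [covVec, covEnd, comp_mulVec, add_mulVec, sub_mulVec, mulVec_add, mulVec_mulVec]
  abel

theorem divEnd_add (S T : Matrix ι ι R) : divEnd d Γ (S + T) = divEnd d Γ S + divEnd d Γ T := by
  ext i; simp [divEnd, covEnd_add, Finset.sum_add_distrib]

omit [DecidableEq ι] in
theorem covVec_comm (hc : ∀ i j x, d i (d j x) = d j (d i x)) (i j : ι) (w : ι → R) :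
    covVec d Γ i (covVec d Γ j w) - covVec d Γ j (covVec d Γ i w) = curv d Γ i j *ᵥ w := by
  have h1 : ∀ i j, d i ∘ (d j ∘ w + Γ j *ᵥ w) =
      d i ∘ d j ∘ w + ((Γ j).map (d i) *ᵥ w + Γ j *ᵥ (d i ∘ w)) := by
    intro i j; rw [← comp_mulVec]; ext k; simp
  have h2 : d i ∘ d j ∘ w = d j ∘ d i ∘ w := by ext k; exact hc _ _ _
  simp only [covVec, curv, h1, h2, mulVec_add, add_mulVec, sub_mulVec, mulVec_mulVec]
  abel

theorem covEnd_comm (hc : ∀ i j x, d i (d j x) = d j (d i x)) (i j : ι) (T : Matrix ι ι R) :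
    covEnd d Γ i (covEnd d Γ j T) - covEnd d Γ j (covEnd d Γ i T) =
      curv d Γ i j * T - T * curv d Γ i j := by
  have h1 : ∀ i j, (T.map (d j) + Γ j * T - T * Γ j).map (d i) =
      (T.map (d j)).map (d i) + ((Γ j).map (d i) * T + Γ j * T.map (d i))
        - (T.map (d i) * Γ j + T * (Γ j).map (d i)) := by
    intro i j; rw [← map_mul, ← map_mul]; ext k; simp
  have h2 : (T.map (d j)).map (d i) = (T.map (d i)).map (d j) := by
    ext k; exact hc _ _ _
  simp only [covEnd, curv, h1, h2]
  noncomm_ring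

end Connection

section LeviCivita

variable {d : ι → Derivation ℝ R R} {Γ : ι → Matrix ι ι R} {g : Matrix ι ι R}
  (h : IsLeviCivita d Γ g)
include h

theorem IsLeviCivita.comp_lower (k : ι) (v : ι → R) :
    d k ∘ (g *ᵥ v) = g *ᵥ covVec d Γ k v + (g *ᵥ v) ᵥ* Γ k := by
  rw [comp_mulVec, h.compat, covVec, ← mulVec_transpose (Γ k), mulVec_mulVec, add_mulVec,
    mulVec_add, mulVec_mulVec]
  abel

theorem IsLeviCivita.apply_inner (k : ι) (v w : ι → R) :
    d k (v ⬝ᵥ g *ᵥ w) = covVec d Γ k v ⬝ᵥ g *ᵥ w + v ⬝ᵥ g *ᵥ covVec d Γ k w := by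
  rw [apply_dotProduct, h.comp_lower, comp_eq_covVec (Γ := Γ), sub_dotProduct, dotProduct_add,
    dotProduct_comm v ((g *ᵥ w) ᵥ* Γ k), ← dotProduct_mulVec, dotProduct_comm (g *ᵥ w)]
  ring

theorem IsLeviCivita.covEnd_vecMulVec (k : ι) (a b : ι → R) :
    covEnd d Γ k (vecMulVec a (g *ᵥ b)) =
      vecMulVec (covVec d Γ k a) (g *ᵥ b) + vecMulVec a (g *ᵥ covVec d Γ k b) := by
  rw [covEnd, map_vecMulVec, h.comp_lower, mul_vecMulVec, vecMulVec_mul,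
    comp_eq_covVec (Γ := Γ), sub_vecMulVec, vecMulVec_add]
  abel

theorem IsLeviCivita.sum_symbol (i : ι) (X : Matrix ι ι R) :
    ∑ j, (X * Γ j) j i = trace (X * Γ i) := by
  simp only [trace, diag, mul_apply]
  exact Finset.sum_congr rfl fun j _ => Finset.sum_congr rfl fun m _ => by rw [h.torsion]

theorem IsLeviCivita.apply_divVec (i : ι) (w : ι → R) :
    d i (divVec d Γ w) = divEnd d Γ (jac d Γ w) i - (ric d Γ *ᵥ w) i := by
  have e1 : ∀ j, d i (covVec d Γ j w j) =
      d j (covVec d Γ i w j) + (Γ j *ᵥ covVec d Γ i w) j + (curv d Γ i j *ᵥ w) j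
        - (Γ i *ᵥ covVec d Γ j w) j := by
    intro j
    have e := congrFun (covVec_comm (Γ := Γ) h.comm i j w) j
    have e0 : ∀ (k : ι) (v : ι → R), covVec d Γ k v j = d k (v j) + (Γ k *ᵥ v) j :=
      fun _ _ => rfl
    rw [Pi.sub_apply, e0 i (covVec d Γ j w), e0 j (covVec d Γ i w)] at e
    linear_combination e
  have e2 : ∑ j, (Γ i *ᵥ covVec d Γ j w) j = ∑ j, (jac d Γ w * Γ j) j i := by
    rw [h.sum_symbol, trace_mul_comm]
    rfl
  have e3 : (ric d Γ *ᵥ w) i = -∑ j, (curv d Γ i j *ᵥ w) j := by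
    simp only [ric, mulVec, dotProduct, of_apply, neg_mul, Finset.sum_mul,
      Finset.sum_neg_distrib]
    rw [Finset.sum_comm]
  have e4 : ∀ j, covEnd d Γ j (jac d Γ w) j i =
      d j (covVec d Γ i w j) + (Γ j *ᵥ covVec d Γ i w) j - (jac d Γ w * Γ j) j i := fun j => rfl
  rw [divVec, map_sum, divEnd, e3]
  simp only [e1, e4, Finset.sum_add_distrib, Finset.sum_sub_distrib, e2]
  ring

theorem IsLeviCivita.mul_inv : g * g⁻¹ = 1 := mul_nonsing_inv g h.nondeg
theorem IsLeviCivita.inv_mul : g⁻¹ * g = 1 := nonsing_inv_mul g h.nondeg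
theorem IsLeviCivita.inv_symm : (g⁻¹)ᵀ = g⁻¹ := by rw [transpose_nonsing_inv, h.symm]

theorem IsLeviCivita.map_inv (k : ι) : g⁻¹.map (d k) = -(Γ k * g⁻¹) - g⁻¹ * (Γ k)ᵀ := by
  rw [DiffAlg.map_inv _ h.nondeg, h.compat, Matrix.mul_add, Matrix.add_mul,
    ← Matrix.mul_assoc g⁻¹ g, h.inv_mul, Matrix.one_mul, ← Matrix.mul_assoc,
    Matrix.mul_assoc _ g, h.mul_inv, Matrix.mul_one]
  abel

theorem IsLeviCivita.isSymm_mul_jac {v : ι → R}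
    (hv : ∀ k l, d k ((g *ᵥ v) l) = d l ((g *ᵥ v) k)) : (g * jac d Γ v).IsSymm := by
  have e : ∀ k l, (g * jac d Γ v) l k = d k ((g *ᵥ v) l) - ((g *ᵥ v) ᵥ* Γ k) l := by
    intro k l
    have := congrFun (h.comp_lower k v) l
    simp only [Pi.add_apply, Function.comp_apply] at this
    rw [this]
    simp [mul_apply, mulVec, dotProduct, jac]
  refine IsSymm.ext fun k l => ?_
  rw [e, e, hv]
  congr 1
  exact Finset.sum_congr rfl fun m _ => congrArg _ (h.torsion _ _ _)

theorem IsLeviCivita.divVec_eq {u : R} (hu : ∀ k, d k u = u * trace (Γ k)) (v : ι → R) :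
    u * divVec d Γ v = ∑ i, d i (u * v i) := by
  have e : ∑ k, trace (Γ k) * v k = ∑ k, (Γ k *ᵥ v) k := by
    simp only [trace, diag, mulVec, dotProduct, Finset.sum_mul]
    rw [Finset.sum_comm]
    exact Finset.sum_congr rfl fun j _ => Finset.sum_congr rfl fun m _ => by rw [h.torsion]
  simp only [divVec, covVec, Pi.add_apply, Function.comp_apply, Derivation.leibniz, hu,
    smul_eq_mul, Finset.sum_add_distrib, mul_add, ← e, Finset.mul_sum]
  congr 1
  exact Finset.sum_congr rfl fun m _ => by ring

/-- The double divergence of a skew-symmetric bivector field vanishes. -/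
theorem IsLeviCivita.divVec_divEnd_eq_zero {u : R} (hu0 : IsUnit u)
    (hu : ∀ k, d k u = u * trace (Γ k)) {C : Matrix ι ι R} (hC : (g * C)ᵀ = -(g * C)) :
    divVec d Γ (g⁻¹ *ᵥ divEnd d Γ C) = 0 := by
  set E := C * g⁻¹ with hE
  have hskew : Eᵀ = -E := by
    have : E = g⁻¹ * (g * C) * g⁻¹ := by rw [← Matrix.mul_assoc, h.inv_mul, Matrix.one_mul]
    rw [this, transpose_mul, transpose_mul, hC, h.inv_symm]
    noncomm_ring
  have hsk : ∀ i j, E i j = - E j i := fun i j => congrFun (congrFun hskew j) i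
  have e1 : ∀ j, covEnd d Γ j C * g⁻¹ = E.map (d j) + Γ j * E + E * (Γ j)ᵀ := by
    intro j
    rw [hE, covEnd, map_mul, h.map_inv]
    noncomm_ring
  have e2 : ∀ i, (g⁻¹ *ᵥ divEnd d Γ C) i = ∑ j, (covEnd d Γ j C * g⁻¹) j i := by
    intro i
    simp only [mulVec, dotProduct, divEnd, mul_apply, Finset.mul_sum]
    rw [Finset.sum_comm]
    refine Finset.sum_congr rfl fun j _ => Finset.sum_congr rfl fun l _ => ?_
    rw [mul_comm, ← congrFun (congrFun h.inv_symm l) i, transpose_apply]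
  have two : ∀ x : R, x = -x → x = 0 := by
    intro x hx
    have : (2 : ℝ) • x = 0 := by rw [two_smul]; nth_rewrite 2 [hx]; ring
    have h3 := congrArg (fun y => (2⁻¹ : ℝ) • y) this
    simpa [smul_smul] using h3
  have e3 : ∀ i, ∑ j, (E * (Γ j)ᵀ) j i = 0 := by
    intro i
    apply two
    simp only [mul_apply, transpose_apply]
    conv_rhs => rw [Finset.sum_comm]
    rw [← Finset.sum_neg_distrib]
    refine Finset.sum_congr rfl fun j _ => ?_
    rw [← Finset.sum_neg_distrib]
    refine Finset.sum_congr rfl fun l _ => ?_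
    rw [hsk j l, h.torsion j l i]
    ring
  have e4 : ∀ i, u * (g⁻¹ *ᵥ divEnd d Γ C) i = ∑ j, d j (u * E j i) := by
    intro i
    have e5 : ∑ j, (Γ j * E) j i = ∑ j, trace (Γ j) * E j i := by
      simp only [trace, diag, mul_apply, Finset.sum_mul]
      conv_rhs => rw [Finset.sum_comm]
      exact Finset.sum_congr rfl fun j _ => Finset.sum_congr rfl fun m _ => by rw [h.torsion]
    rw [e2]
    simp only [e1, Matrix.add_apply, Finset.sum_add_distrib, e3, e5, Derivation.leibniz, hu, map_apply,
      smul_eq_mul, add_zero, mul_add, Finset.mul_sum]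
    congr 1
    exact Finset.sum_congr rfl fun j _ => by ring
  rw [← hu0.mul_right_inj, mul_zero, h.divVec_eq hu]
  simp only [e4, map_sum]
  apply two
  conv_lhs => rw [Finset.sum_comm]
  rw [← Finset.sum_neg_distrib]
  refine Finset.sum_congr rfl fun j _ => ?_
  rw [← Finset.sum_neg_distrib]
  refine Finset.sum_congr rfl fun l _ => ?_
  rw [h.comm, hsk j l, mul_neg, map_neg, map_neg]

end LeviCivita

section Curvature

theorem two_mul_inj {x y : R} (hxy : 2 * x = 2 * y) : x = y := by
  have h3 := congrArg (fun z => (2⁻¹ : ℝ) • z) hxy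
  have e : ∀ z : R, 2 * z = (2 : ℝ) • z := fun z => by rw [two_smul, two_mul]
  simpa [e, smul_smul] using h3

variable {d : ι → Derivation ℝ R R} {Γ : ι → Matrix ι ι R} {g : Matrix ι ι R}

omit [DecidableEq ι] in
theorem curv_swap (i j : ι) : curv d Γ j i = -curv d Γ i j := by
  simp only [curv]; abel

variable (h : IsLeviCivita d Γ g)
include h

theorem IsLeviCivita.mul_curv_transpose (i j : ι) :
    (g * curv d Γ i j)ᵀ = -(g * curv d Γ i j) := by
  have e : ∀ i j, (g.map (d j)).map (d i) =
      (Γ j)ᵀ.map (d i) * g + (Γ j)ᵀ * ((Γ i)ᵀ * g + g * Γ i)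
        + (((Γ i)ᵀ * g + g * Γ i) * Γ j + g * (Γ j).map (d i)) := by
    intro i j
    rw [h.compat j, ← h.compat i, ← map_mul, ← map_mul]
    ext; simp
  have e2 : (g.map (d j)).map (d i) = (g.map (d i)).map (d j) := by ext k; exact h.comm _ _ _
  rw [e, e] at e2
  rw [transpose_mul, h.symm, eq_neg_iff_add_eq_zero]
  simp only [curv, transpose_add, transpose_sub, transpose_mul, transpose_map] at e2 ⊢
  rw [← sub_eq_zero] at e2
  rw [← e2]
  noncomm_ring

theorem IsLeviCivita.bianchi (i j k m : ι) :
    (g * curv d Γ i j) m k + (g * curv d Γ j k) m i + (g * curv d Γ k i) m j = 0 := by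
  have e : ∀ i j k s, (Γ i * Γ j) s k = (Γ i * Γ k) s j := fun i j k s => by
    simp only [mul_apply]
    exact Finset.sum_congr rfl fun t _ => by rw [h.torsion j k t]
  have e1 : ∀ s, curv d Γ i j s k + curv d Γ j k s i + curv d Γ k i s j = 0 := by
    intro s
    simp only [curv, Matrix.add_apply, Matrix.sub_apply, map_apply]
    rw [e i k j, e j k i, e k j i, h.torsion j i s, h.torsion k i s, h.torsion k j s]
    ring
  simp only [mul_apply, ← Finset.sum_add_distrib, ← mul_add, e1, mul_zero,
    Finset.sum_const_zero]

theorem IsLeviCivita.curv_pair_symm (i j m k : ι) :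
    (g * curv d Γ i j) m k = (g * curv d Γ m k) i j := by
  have s1 : ∀ i j m k, (g * curv d Γ j i) m k = -(g * curv d Γ i j) m k := by
    intro i j m k; rw [curv_swap i j]; simp
  have s2 : ∀ i j m k, (g * curv d Γ i j) k m = -(g * curv d Γ i j) m k := by
    intro i j m k; exact congrFun (congrFun (h.mul_curv_transpose i j) m) k
  apply two_mul_inj
  have b1 := h.bianchi i j k m
  have b2 := h.bianchi j k m i
  have b3 := h.bianchi i k m j
  have b4 := h.bianchi i j m k
  rw [s2 j k m i, s1 m k i j, s2 m j k i] at b2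
  rw [s1 k i j m, s2 k i m j, s1 m k j i, s2 m k i j] at b3
  rw [s2 i j m k, s1 m j k i, s2 m i j k] at b4
  linear_combination b1 + b2 - b3 - b4

/-- Self-adjoint endomorphism fields `A` with `∇_k A = e_k ⊗ l♭ + l ⊗ e_k♭`. -/
structure IsSinjukov (d : ι → Derivation ℝ R R) (Γ : ι → Matrix ι ι R) (g A : Matrix ι ι R)
    (l : ι → R) : Prop where
  symm : (g * A).IsSymm
  cov : ∀ k, covEnd d Γ k A =
    vecMulVec (Pi.single k 1) (g *ᵥ l) + vecMulVec l (g *ᵥ Pi.single k 1)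

omit h in
theorem covVec_single (i j : ι) :
    covVec d Γ i (Pi.single j 1) = fun s => Γ i s j := by
  ext s
  by_cases hs : s = j <;> simp [covVec, hs]

omit h [DecidableEq ι] in
theorem trace_covEnd (k : ι) (T : Matrix ι ι R) : trace (covEnd d Γ k T) = d k (trace T) := by
  rw [covEnd, trace_sub, trace_add, trace_mul_comm T, add_sub_cancel_right, trace, trace, map_sum]
  rfl

theorem IsSinjukov.closed {A : Matrix ι ι R} {l : ι → R} (hA : IsSinjukov d Γ g A l) (k m : ι) :
    d k ((g *ᵥ l) m) = d m ((g *ᵥ l) k) := by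
  have e : ∀ k, d k (trace A) = 2 * (g *ᵥ l) k := by
    intro k
    rw [← trace_covEnd (Γ := Γ), hA.cov, trace_add, trace_vecMulVec, trace_vecMulVec,
      single_one_dotProduct, dotProduct_mulVec, ← mulVec_transpose, h.symm,
      dotProduct_single_one]
    ring
  have e2 : ∀ k x, d k (2 * x) = 2 * d k x := by
    intro k x; rw [two_mul, map_add, two_mul]
  apply two_mul_inj
  rw [← e2, ← e, ← e2, ← e, h.comm]

theorem IsSinjukov.ric_mul_isSymm {A : Matrix ι ι R} {l : ι → R} (hA : IsSinjukov d Γ g A l) :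
    (ric d Γ * A).IsSymm := by
  have hH := h.isSymm_mul_jac (v := l) (fun k m => hA.closed h k m)
  have hgc : ∀ i k, (g *ᵥ covVec d Γ i l) k = (g * jac d Γ l) k i := by
    intro i k; simp [mul_apply, mulVec, dotProduct, jac]
  set B := A * g⁻¹ with hB
  have hBs : ∀ i j, B j i = B i j := by
    have : B = g⁻¹ * (g * A) * g⁻¹ := by
      rw [← Matrix.mul_assoc, h.inv_mul, Matrix.one_mul]
    have : B.IsSymm := by
      rw [IsSymm, this, transpose_mul, transpose_mul, hA.symm, h.inv_symm,
        ← Matrix.mul_assoc]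
    exact fun i j => this.apply i j
  have hX : ∀ i k, ∑ j, (A * curv d Γ i j) j k = ∑ j, ∑ m, B j m * (g * curv d Γ i j) m k := by
    intro i k
    refine Finset.sum_congr rfl fun j _ => ?_
    rw [← mul_apply, hB, Matrix.mul_assoc A, ← Matrix.mul_assoc g⁻¹, h.inv_mul, Matrix.one_mul]
  have hXs : ∀ i k, ∑ j, (A * curv d Γ i j) j k = ∑ j, (A * curv d Γ k j) j i := by
    intro i k
    rw [hX, hX, Finset.sum_comm]
    refine Finset.sum_congr rfl fun m _ => Finset.sum_congr rfl fun j _ => ?_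
    have s2 : (g * curv d Γ k m) i j = -(g * curv d Γ k m) j i :=
      congrFun (congrFun (h.mul_curv_transpose k m) j) i
    have s1 : (g * curv d Γ m k) i j = -(g * curv d Γ k m) i j := by
      rw [curv_swap k m]; simp
    rw [hBs, h.curv_pair_symm, s1, s2, neg_neg]
  have hcomm : ∀ i j, curv d Γ i j * A - A * curv d Γ i j =
      vecMulVec (Pi.single j 1) (g *ᵥ covVec d Γ i l)
        + vecMulVec (covVec d Γ i l) (g *ᵥ Pi.single j 1)
      - (vecMulVec (Pi.single i 1) (g *ᵥ covVec d Γ j l)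
        + vecMulVec (covVec d Γ j l) (g *ᵥ Pi.single i 1)) := by
    intro i j
    have hs : covVec d Γ i (Pi.single j 1) = covVec d Γ j (Pi.single i 1) := by
      rw [covVec_single, covVec_single]; ext s; exact h.torsion _ _ _
    rw [← covEnd_comm h.comm, hA.cov, hA.cov, covEnd_add, covEnd_add, h.covEnd_vecMulVec,
      h.covEnd_vecMulVec, h.covEnd_vecMulVec, h.covEnd_vecMulVec, hs]
    abel
  have key : ∀ i k, -(ric d Γ * A) i k - ∑ j, (A * curv d Γ i j) j k =
      (Fintype.card ι : R) * (g * jac d Γ l) k i - divVec d Γ l * g k i := by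
    intro i k
    have e1 : -(ric d Γ * A) i k = ∑ j, (curv d Γ i j * A) j k := by
      simp only [ric, mul_apply, of_apply, neg_mul, Finset.sum_neg_distrib, neg_neg,
        Finset.sum_mul]
      rw [Finset.sum_comm]
    rw [e1, ← Finset.sum_sub_distrib]
    simp only [← Matrix.sub_apply, hcomm]
    have hgT : ∀ i j, g i j = g j i := fun i j => h.symm.apply j i
    have e2 : ∑ j, covVec d Γ i l j * g k j = (g * jac d Γ l) k i := by
      simp [mul_apply, jac, mul_comm]
    simp only [Matrix.sub_apply, Matrix.add_apply, vecMulVec_apply, Pi.single_eq_same, one_mul, hgc,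
      Finset.sum_sub_distrib, Finset.sum_add_distrib, Finset.sum_const, Finset.card_univ,
      mulVec_single_one, col_apply, Pi.single_apply, ite_mul, zero_mul,
      Finset.sum_ite_eq', Finset.mem_univ, if_true, ← Finset.sum_mul, e2,
      nsmul_eq_mul, divVec]
    ring
  refine IsSymm.ext fun i k => ?_
  have k1 := key i k
  have k2 := key k i
  rw [hXs, ← hH.apply, ← h.symm.apply] at k1
  linear_combination k1 - k2

theorem IsLeviCivita.isSinjukov_one : IsSinjukov d Γ g 1 0 where
  symm := by rw [Matrix.mul_one]; exact h.symm
  cov k := by rw [covEnd_one]; simp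

theorem IsLeviCivita.ric_isSymm : (ric d Γ).IsSymm := by
  simpa using h.isSinjukov_one.ric_mul_isSymm h

end Curvature

section Commutation

variable {d : ι → Derivation ℝ R R} {Γ : ι → Matrix ι ι R} {g : Matrix ι ι R}
  (h : IsLeviCivita d Γ g)
include h

theorem IsLeviCivita.lower_vecMul {T : Matrix ι ι R} (hT : (g * T).IsSymm) (a : ι → R) :
    (g *ᵥ a) ᵥ* T = g *ᵥ (T *ᵥ a) := by
  rw [← mulVec_transpose, mulVec_mulVec, mulVec_mulVec, ← hT, transpose_mul, h.symm]

theorem IsLeviCivita.transpose_mul_lower {T : Matrix ι ι R} (hT : (g * T).IsSymm) :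
    Tᵀ * g = g * T := by
  rw [← hT, transpose_mul, h.symm]

theorem IsLeviCivita.eq_of_lower {S T : Matrix ι ι R} (hST : g * S = g * T) : S = T := by
  rw [← Matrix.one_mul S, ← h.inv_mul, Matrix.mul_assoc, hST, ← Matrix.mul_assoc, h.inv_mul,
    Matrix.one_mul]

theorem IsLeviCivita.adjugate_isSymm {A : Matrix ι ι R} (hA : (g * A).IsSymm)
    (hdet : IsUnit A.det) : (g * A.adjugate).IsSymm := by
  have h1 : A * A⁻¹ = 1 := mul_nonsing_inv A hdet
  have h2 : A⁻¹ * A = 1 := nonsing_inv_mul A hdet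
  have hinv : (g * A⁻¹).IsSymm := by
    have e : g * A⁻¹ = (A⁻¹)ᵀ * (g * A) * A⁻¹ := by
      rw [← h.transpose_mul_lower hA, ← Matrix.mul_assoc, ← transpose_mul, h1, transpose_one,
        Matrix.one_mul]
    rw [IsSymm, e, transpose_mul, transpose_mul, hA, transpose_transpose, ← Matrix.mul_assoc]
  have e : A.adjugate = A.det • A⁻¹ := by
    rw [inv_def, smul_smul, Ring.mul_inverse_cancel _ hdet, one_smul]
  rw [IsSymm, e, Matrix.mul_smul, transpose_smul, hinv]

variable {A : Matrix ι ι R} {l : ι → R} (hA : IsSinjukov d Γ g A l) (hdet : IsUnit A.det)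
include hA hdet

theorem IsSinjukov.apply_det (k : ι) :
    d k A.det = 2 * A.det * (g *ᵥ (A⁻¹ *ᵥ l)) k := by
  have hK := h.adjugate_isSymm hA.symm hdet
  have e1 : trace (A.adjugate * A.map (d k)) = trace (A.adjugate * covEnd d Γ k A) := by
    rw [covEnd, Matrix.mul_sub, Matrix.mul_add, trace_sub, trace_add, ← Matrix.mul_assoc,
      ← Matrix.mul_assoc A.adjugate A, adjugate_mul, trace_mul_comm _ A, ← Matrix.mul_assoc,
      mul_adjugate]
    ring
  have e2 : A.adjugate *ᵥ l = A.det • (A⁻¹ *ᵥ l) := by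
    conv_lhs => rw [← one_mulVec l, ← mul_nonsing_inv A hdet, ← mulVec_mulVec]
    rw [mulVec_mulVec, adjugate_mul, smul_mulVec, one_mulVec]
  have e3 : (g *ᵥ A.adjugate *ᵥ l) k = A.det * (g *ᵥ (A⁻¹ *ᵥ l)) k := by
    rw [e2, mulVec_smul]; rfl
  rw [DiffAlg.apply_det, e1, hA.cov, Matrix.mul_add, trace_add, mul_vecMulVec, mul_vecMulVec,
    trace_vecMulVec, trace_vecMulVec, dotProduct_comm, dotProduct_mulVec,
    h.lower_vecMul hK, dotProduct_single_one, e3, dotProduct_mulVec, ← mulVec_transpose, h.symm,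
    dotProduct_single_one, e3]
  ring

theorem IsSinjukov.covEnd_adjugate (k : ι) :
    covEnd d Γ k A.adjugate = (2 * (g *ᵥ (A⁻¹ *ᵥ l)) k) • A.adjugate
      - vecMulVec (A.adjugate *ᵥ Pi.single k 1) (g *ᵥ (A⁻¹ *ᵥ l))
      - vecMulVec (A⁻¹ *ᵥ l) (g *ᵥ (A.adjugate *ᵥ Pi.single k 1)) := by
  have hK := h.adjugate_isSymm hA.symm hdet
  set m := g *ᵥ (A⁻¹ *ᵥ l) with hm
  have e1 := covEnd_mul (d := d) (Γ := Γ) k A A.adjugate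
  rw [mul_adjugate, covEnd_smul, covEnd_one, smul_zero, add_zero, hA.apply_det h hdet,
    ← hm] at e1
  have h2 : A⁻¹ * A = 1 := nonsing_inv_mul A hdet
  have e2 : covEnd d Γ k A.adjugate =
      A⁻¹ * ((2 * A.det * m k) • (1 : Matrix ι ι R)) - A⁻¹ * (covEnd d Γ k A * A.adjugate) := by
    rw [e1, Matrix.mul_add, ← Matrix.mul_assoc A⁻¹ A, h2, Matrix.one_mul]; abel
  have e : A.adjugate = A.det • A⁻¹ := by
    rw [inv_def, smul_smul, Ring.mul_inverse_cancel _ hdet, one_smul]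
  have e3 : g *ᵥ A.adjugate *ᵥ l = A.det • m := by
    rw [e, smul_mulVec, mulVec_smul, hm]
  rw [e2, hA.cov, Matrix.add_mul, Matrix.mul_add, vecMulVec_mul, vecMulVec_mul,
    h.lower_vecMul hK, h.lower_vecMul hK, mul_vecMulVec, mul_vecMulVec, e3, Matrix.mul_smul,
    Matrix.mul_one]
  nth_rewrite 3 [e]
  nth_rewrite 3 [e]
  simp only [smul_mulVec, smul_vecMulVec, vecMulVec_smul, mulVec_smul]
  rw [e]
  simp only [smul_mulVec, vecMulVec_smul, mulVec_smul, smul_smul]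
  module

theorem IsSinjukov.isSymm_mul_jac_inv : (g * jac d Γ (A⁻¹ *ᵥ l)).IsSymm := by
  apply h.isSymm_mul_jac
  intro k m
  have hD := h.comm k m A.det
  rw [hA.apply_det h hdet, hA.apply_det h hdet, (d k).leibniz (2 * A.det) _,
    (d m).leibniz (2 * A.det) _]
    at hD
  have e2 : ∀ k, d k (2 * A.det) = 2 * d k A.det := by
    intro k; rw [two_mul, map_add, two_mul]
  rw [e2, e2, hA.apply_det h hdet, hA.apply_det h hdet] at hD
  rw [← hdet.mul_right_inj]
  apply two_mul_inj
  simp only [smul_eq_mul] at hD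
  linear_combination hD

theorem IsSinjukov.adjugate_comm :
    A.adjugate * (jac d Γ (A⁻¹ *ᵥ l) + vecMulVec (A⁻¹ *ᵥ l) (g *ᵥ (A⁻¹ *ᵥ l))) =
      (jac d Γ (A⁻¹ *ᵥ l) + vecMulVec (A⁻¹ *ᵥ l) (g *ᵥ (A⁻¹ *ᵥ l))) * A.adjugate := by
  set w := A⁻¹ *ᵥ l with hw
  have hAw : A *ᵥ w = l := by
    rw [hw, mulVec_mulVec, mul_nonsing_inv A hdet, one_mulVec]
  have hH := h.isSymm_mul_jac (v := l) (fun k m => hA.closed h k m)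
  have hout : (g * vecMulVec w (g *ᵥ w)).IsSymm := by
    rw [mul_vecMulVec, IsSymm, transpose_vecMulVec]
  have hQ : (g * jac d Γ w).IsSymm := hA.isSymm_mul_jac_inv h hdet
  have hQ' : (g * (jac d Γ w + vecMulVec w (g *ᵥ w))).IsSymm := by
    rw [Matrix.mul_add, IsSymm, transpose_add, hQ, hout]
  set Q := jac d Γ w + vecMulVec w (g *ᵥ w) with hQdef
  have e : A * Q = jac d Γ l - ((g *ᵥ l) ⬝ᵥ w) • (1 : Matrix ι ι R) := by
    ext i k
    have e1 := congrFun (covVec_mulVec (d := d) (Γ := Γ) k A w) i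
    rw [hAw, hA.cov, add_mulVec, vecMulVec_mulVec, vecMulVec_mulVec] at e1
    have e3 : (g *ᵥ Pi.single k 1) ⬝ᵥ w = (g *ᵥ w) k := by
      rw [dotProduct_comm, dotProduct_mulVec, ← mulVec_transpose, h.symm, dotProduct_single_one]
    have e4 : (A * jac d Γ w) i k = (A *ᵥ covVec d Γ k w) i := rfl
    rw [hQdef, Matrix.mul_add, mul_vecMulVec, hAw, Matrix.add_apply, e4, Matrix.sub_apply,
      vecMulVec_apply, Matrix.smul_apply, jac, of_apply, e1, e3]
    simp [Pi.single_apply, one_apply, mul_comm]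
    ring
  have hAQ : (g * (A * Q)).IsSymm := by
    rw [e, Matrix.mul_sub, IsSymm, transpose_sub, hH, Matrix.mul_smul, Matrix.mul_one,
      transpose_smul, h.symm]
  have hc : A * Q = Q * A := by
    apply h.eq_of_lower
    rw [← hAQ, ← Matrix.mul_assoc, transpose_mul, hA.symm.eq, ← Matrix.mul_assoc,
      h.transpose_mul_lower hQ', Matrix.mul_assoc]
  have h2 : A⁻¹ * A = 1 := nonsing_inv_mul A hdet
  rw [← Matrix.one_mul (A.adjugate * Q), ← Matrix.one_mul (Q * A.adjugate), ← h2,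
    Matrix.mul_assoc A⁻¹, Matrix.mul_assoc A⁻¹, ← Matrix.mul_assoc A, mul_adjugate,
    ← Matrix.mul_assoc A, hc, Matrix.mul_assoc Q, mul_adjugate]
  simp

end Commutation

section Divergence

variable {d : ι → Derivation ℝ R R} {Γ : ι → Matrix ι ι R} {g : Matrix ι ι R}

omit [DecidableEq ι] in
theorem divVec_add (v w : ι → R) : divVec d Γ (v + w) = divVec d Γ v + divVec d Γ w := by
  have : ∀ k, d k ∘ (v + w) = d k ∘ v + d k ∘ w := fun k => by ext; simp
  simp only [divVec, covVec, this, mulVec_add, ← Finset.sum_add_distrib, Pi.add_apply]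
  exact Finset.sum_congr rfl fun j _ => by ring

theorem divEnd_sub (S T : Matrix ι ι R) : divEnd d Γ (S - T) = divEnd d Γ S - divEnd d Γ T := by
  rw [eq_sub_iff_add_eq, ← divEnd_add, sub_add_cancel]

omit [DecidableEq ι] in
theorem divEnd_smul (a : R) (T : Matrix ι ι R) :
    divEnd d Γ (a • T) = (fun k => d k a) ᵥ* T + a • divEnd d Γ T := by
  ext i
  simp [divEnd, covEnd_smul, Finset.sum_add_distrib, vecMul, dotProduct, Finset.mul_sum]

theorem divEnd_mul (S T : Matrix ι ι R) :
    divEnd d Γ (S * T) = divEnd d Γ S ᵥ* T + fun i => ∑ j, (S * covEnd d Γ j T) j i := by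
  ext i
  simp only [divEnd, covEnd_mul, Matrix.add_apply, Finset.sum_add_distrib, Pi.add_apply, vecMul,
    dotProduct, Finset.sum_mul]
  congr 1
  simp only [mul_apply]
  rw [Finset.sum_comm]

omit [DecidableEq ι] in
theorem divVec_eq_trace (v : ι → R) : divVec d Γ v = trace (jac d Γ v) := rfl

variable (h : IsLeviCivita d Γ g)
include h

theorem IsLeviCivita.divEnd_vecMulVec (a b : ι → R) :
    divEnd d Γ (vecMulVec a (g *ᵥ b)) =
      divVec d Γ a • (g *ᵥ b) + g *ᵥ (jac d Γ b *ᵥ a) := by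
  ext i
  simp only [divEnd, h.covEnd_vecMulVec, Matrix.add_apply, vecMulVec_apply,
    Finset.sum_add_distrib, Pi.add_apply, Pi.smul_apply, smul_eq_mul, divVec, Finset.sum_mul]
  congr 1
  simp only [mulVec, dotProduct, jac, of_apply, Finset.mul_sum]
  rw [Finset.sum_comm]
  exact Finset.sum_congr rfl fun j _ => Finset.sum_congr rfl fun m _ => by ring

theorem IsLeviCivita.dotProduct_lower (a b : ι → R) : a ⬝ᵥ g *ᵥ b = (g *ᵥ a) ⬝ᵥ b := by
  rw [dotProduct_mulVec, ← mulVec_transpose, h.symm]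

variable {A : Matrix ι ι R} {l : ι → R} (hA : IsSinjukov d Γ g A l) (hdet : IsUnit A.det)
include hA hdet

theorem IsSinjukov.sum_mul_covEnd_adjugate (X : Matrix ι ι R) :
    (fun i => ∑ j, (X * covEnd d Γ j A.adjugate) j i) =
      (2 : R) • ((g *ᵥ (A⁻¹ *ᵥ l)) ᵥ* (X * A.adjugate))
        - trace (X * A.adjugate) • (g *ᵥ (A⁻¹ *ᵥ l))
        - g *ᵥ (A.adjugate *ᵥ (X *ᵥ (A⁻¹ *ᵥ l))) := by
  have e : ∀ j, g *ᵥ (A.adjugate *ᵥ Pi.single j 1) = fun i => (g * A.adjugate) i j := by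
    intro j; rw [mulVec_mulVec, mulVec_single_one]; rfl
  have e' : ∀ j, X *ᵥ (A.adjugate *ᵥ Pi.single j 1) = fun i => (X * A.adjugate) i j := by
    intro j; rw [mulVec_mulVec, mulVec_single_one]; rfl
  ext i
  rw [mulVec_mulVec _ g A.adjugate]
  simp only [hA.covEnd_adjugate h hdet, Matrix.mul_sub, Matrix.mul_smul, mul_vecMulVec, e, e',
    Matrix.sub_apply, Matrix.smul_apply, vecMulVec_apply, Finset.sum_sub_distrib, Pi.sub_apply,
    Pi.smul_apply, smul_eq_mul]
  congr 1
  · congr 1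
    · simp only [vecMul, dotProduct, Finset.mul_sum, mul_assoc]
    · simp only [trace, diag, Finset.sum_mul]
  · simp only [mulVec, dotProduct]
    exact Finset.sum_congr rfl fun j _ => mul_comm _ _

theorem IsSinjukov.jac_adjugate_mulVec (v : ι → R) :
    jac d Γ (A.adjugate *ᵥ v) = A.adjugate * jac d Γ v
      + (2 : R) • vecMulVec (A.adjugate *ᵥ v) (g *ᵥ (A⁻¹ *ᵥ l))
      - (v ⬝ᵥ g *ᵥ (A⁻¹ *ᵥ l)) • A.adjugate
      - vecMulVec (A⁻¹ *ᵥ l) (g *ᵥ (A.adjugate *ᵥ v)) := by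
  have hK := h.adjugate_isSymm hA.symm hdet
  ext i k
  have e1 : (A.adjugate * jac d Γ v) i k = (A.adjugate *ᵥ covVec d Γ k v) i := rfl
  have e2 : (g *ᵥ (A.adjugate *ᵥ Pi.single k 1)) ⬝ᵥ v = (g *ᵥ (A.adjugate *ᵥ v)) k := by
    rw [← h.lower_vecMul hK, ← dotProduct_mulVec, ← h.dotProduct_lower,
      single_one_dotProduct]
  have e3 : (A.adjugate *ᵥ Pi.single k 1) i = A.adjugate i k := by
    rw [mulVec_single_one]; rfl
  simp only [jac, of_apply, covVec_mulVec, hA.covEnd_adjugate h hdet] at e1 ⊢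
  simp only [Matrix.sub_apply, Matrix.add_apply, e1, sub_mulVec, smul_mulVec, vecMulVec_mulVec,
    Pi.add_apply, Pi.sub_apply, Pi.smul_apply, Matrix.smul_apply, vecMulVec_apply, e2, e3,
    dotProduct_comm (g *ᵥ (A⁻¹ *ᵥ l)) v, MulOpposite.smul_eq_mul_unop, MulOpposite.unop_op,
    smul_eq_mul]
  ring

theorem IsSinjukov.divEnd_eq_vecMul {v : ι → R}
    (hv : ∀ k m, d k ((g *ᵥ v) m) = d m ((g *ᵥ v) k)) :
    divEnd d Γ (jac d Γ v * A.adjugate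
        + vecMulVec (A.adjugate *ᵥ v) (g *ᵥ (A⁻¹ *ᵥ l))
        - (v ⬝ᵥ g *ᵥ (A⁻¹ *ᵥ l)) • A.adjugate) =
      divEnd d Γ (jac d Γ v) ᵥ* A.adjugate := by
  have hK := h.adjugate_isSymm hA.symm hdet
  have hS := h.isSymm_mul_jac hv
  have hQ := hA.isSymm_mul_jac_inv h hdet
  have hc := congrArg (fun T => g *ᵥ (T *ᵥ v)) (hA.adjugate_comm h hdet)
  have hdiv : divVec d Γ (A.adjugate *ᵥ v) = trace (jac d Γ v * A.adjugate)
      + (A.adjugate *ᵥ v) ⬝ᵥ g *ᵥ (A⁻¹ *ᵥ l)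
      - (v ⬝ᵥ g *ᵥ (A⁻¹ *ᵥ l)) * trace A.adjugate := by
    rw [divVec_eq_trace, hA.jac_adjugate_mulVec h hdet]
    simp only [trace_sub, trace_add, trace_smul, trace_vecMulVec, smul_eq_mul,
      trace_mul_comm A.adjugate]
    rw [h.dotProduct_lower (A⁻¹ *ᵥ l), dotProduct_comm _ (A.adjugate *ᵥ v)]
    ring
  have hdK : divEnd d Γ A.adjugate =
      g *ᵥ (A.adjugate *ᵥ (A⁻¹ *ᵥ l)) - trace A.adjugate • (g *ᵥ (A⁻¹ *ᵥ l)) := by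
    have := hA.sum_mul_covEnd_adjugate h hdet 1
    simp only [Matrix.one_mul, one_mulVec, h.lower_vecMul hK] at this
    change divEnd d Γ A.adjugate = _ at this
    rw [this]
    module
  have hdφ : (fun k => d k (v ⬝ᵥ g *ᵥ (A⁻¹ *ᵥ l))) =
      g *ᵥ (jac d Γ v *ᵥ (A⁻¹ *ᵥ l)) + g *ᵥ (jac d Γ (A⁻¹ *ᵥ l) *ᵥ v) := by
    ext k
    rw [h.apply_inner, ← h.lower_vecMul hS, ← h.lower_vecMul hQ, h.dotProduct_lower v,
      dotProduct_comm (covVec d Γ k v)]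
    rfl
  rw [divEnd_sub, divEnd_add, divEnd_mul, h.divEnd_vecMulVec, divEnd_smul, hdφ, hdK,
    hA.sum_mul_covEnd_adjugate h hdet, hdiv, add_vecMul, h.lower_vecMul hK, h.lower_vecMul hK,
    ← vecMul_vecMul, h.lower_vecMul hS, h.lower_vecMul hK]
  simp only [← mulVec_mulVec, add_mulVec, mulVec_add, vecMulVec_mulVec, op_smul_eq_smul,
    mulVec_smul] at hc
  rw [dotProduct_comm (g *ᵥ (A⁻¹ *ᵥ l)) v, dotProduct_comm (g *ᵥ (A⁻¹ *ᵥ l))] at hc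
  rw [← sub_eq_zero] at hc ⊢
  rw [← neg_eq_zero, ← hc]
  module

theorem IsSinjukov.ric_mul_adjugate : ric d Γ * A.adjugate = A.adjugateᵀ * ric d Γ := by
  have h1 : ric d Γ * A = Aᵀ * ric d Γ := by
    have := (hA.ric_mul_isSymm h).eq
    rw [transpose_mul, h.ric_isSymm.eq] at this
    exact this.symm
  have hdet' : IsUnit Aᵀ.det := by rwa [det_transpose]
  have h2 : (Aᵀ)⁻¹ * Aᵀ = 1 := nonsing_inv_mul _ hdet'
  rw [← Matrix.one_mul (ric d Γ * A.adjugate), ← Matrix.one_mul (A.adjugateᵀ * ric d Γ), ← h2,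
    Matrix.mul_assoc, Matrix.mul_assoc, ← Matrix.mul_assoc Aᵀ, ← h1, Matrix.mul_assoc (ric d Γ),
    mul_adjugate, ← Matrix.mul_assoc Aᵀ, ← transpose_mul, adjugate_mul, transpose_smul,
    transpose_one]
  simp

/-- The second order operators with symbols `adj(A) g⁻¹` and `g⁻¹` commute. -/
theorem IsSinjukov.commute {u : R} (hu0 : IsUnit u) (hu : ∀ k, d k u = u * trace (Γ k)) (f : R) :
    divVec d Γ (g⁻¹ *ᵥ fun i => d i (divVec d Γ ((A.adjugate * g⁻¹) *ᵥ fun i => d i f))) =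
      divVec d Γ ((A.adjugate * g⁻¹) *ᵥ fun i => d i (divVec d Γ (g⁻¹ *ᵥ fun i => d i f))) := by
  have hK := h.adjugate_isSymm hA.symm hdet
  set v := g⁻¹ *ᵥ fun i => d i f with hvdef
  have hgv : g *ᵥ v = fun i => d i f := by rw [hvdef, mulVec_mulVec, h.mul_inv, one_mulVec]
  have hv : ∀ k m, d k ((g *ᵥ v) m) = d m ((g *ᵥ v) k) := by
    intro k m; rw [hgv]; exact h.comm _ _ _
  clear_value v
  have hS := h.isSymm_mul_jac hv
  have hKg : ∀ x, (A.adjugate * g⁻¹) *ᵥ x = g⁻¹ *ᵥ (x ᵥ* A.adjugate) := by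
    intro x
    have : A.adjugate * g⁻¹ = g⁻¹ * A.adjugateᵀ := by
      rw [← Matrix.one_mul (A.adjugate * g⁻¹), ← h.inv_mul, Matrix.mul_assoc,
        ← Matrix.mul_assoc g A.adjugate, ← h.transpose_mul_lower hK, Matrix.mul_assoc _ g,
        h.mul_inv, Matrix.mul_one]
    rw [this, ← mulVec_mulVec, mulVec_transpose]
  set D := jac d Γ v * A.adjugate + vecMulVec (A.adjugate *ᵥ v) (g *ᵥ (A⁻¹ *ᵥ l))
        - (v ⬝ᵥ g *ᵥ (A⁻¹ *ᵥ l)) • A.adjugate with hD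
  have hC : (g * (jac d Γ (A.adjugate *ᵥ v) - D))ᵀ = -(g * (jac d Γ (A.adjugate *ᵥ v) - D)) := by
    have e : jac d Γ (A.adjugate *ᵥ v) - D = A.adjugate * jac d Γ v - jac d Γ v * A.adjugate
        + (vecMulVec (A.adjugate *ᵥ v) (g *ᵥ (A⁻¹ *ᵥ l))
          - vecMulVec (A⁻¹ *ᵥ l) (g *ᵥ (A.adjugate *ᵥ v))) := by
      rw [hA.jac_adjugate_mulVec h hdet, hD]; module
    rw [e]
    simp only [Matrix.mul_add, Matrix.mul_sub, transpose_add, transpose_sub, mul_vecMulVec,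
      transpose_vecMulVec, ← Matrix.mul_assoc, ← h.transpose_mul_lower hK]
    rw [Matrix.mul_assoc, transpose_mul, hS.eq, Matrix.transpose_transpose,
      ← h.transpose_mul_lower hS, transpose_mul (_ * g), transpose_mul _ g, transpose_transpose,
      h.symm.eq, h.transpose_mul_lower hS, Matrix.mul_assoc]
    abel
  have e1 : (fun i => d i (divVec d Γ (A.adjugate *ᵥ v))) =
      (fun i => d i (divVec d Γ v)) ᵥ* A.adjugate + divEnd d Γ (jac d Γ (A.adjugate *ᵥ v) - D) := by
    have e2 : ∀ w, (fun i => d i (divVec d Γ w)) = divEnd d Γ (jac d Γ w) - ric d Γ *ᵥ w := by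
      intro w; ext i; exact h.apply_divVec i w
    rw [e2, e2, sub_vecMul, divEnd_sub, hA.divEnd_eq_vecMul h hdet hv, ← mulVec_transpose _ (ric d Γ *ᵥ v),
      mulVec_mulVec, mulVec_mulVec, hA.ric_mul_adjugate h hdet]
    abel
  rw [← mulVec_mulVec, ← hvdef, e1, mulVec_add, divVec_add, h.divVec_divEnd_eq_zero hu0 hu hC,
    add_zero, hKg]

end Divergence

section Projective

variable {d : ι → Derivation ℝ R R}

/-- The Christoffel symbols `Γ^i_{kj}` of `g`, as the family of matrices `christoffel d g k`. -/
noncomputable def christoffel (d : ι → Derivation ℝ R R) (g : Matrix ι ι R) (k : ι) :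
    Matrix ι ι R :=
  of fun i j => (1 / 2 : ℝ) • ∑ l, g⁻¹ i l * (d k (g l j) + d j (g l k) - d l (g k j))

theorem isLeviCivita_christoffel {g : Matrix ι ι R} (hd : ∀ i j x, d i (d j x) = d j (d i x))
    (hs : g.IsSymm) (hg : IsUnit g.det) : IsLeviCivita d (christoffel d g) g where
  comm := hd
  symm := hs
  nondeg := hg
  torsion i j k := by
    simp only [christoffel, of_apply]
    congr 1
    refine Finset.sum_congr rfl fun l _ => ?_
    rw [hs.apply i j]
    ring
  compat k := by
    have e : ∀ i j, (g * christoffel d g k) i j =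
        (1 / 2 : ℝ) • (d k (g i j) + d j (g i k) - d i (g k j)) := by
      intro i j
      set Y : Matrix ι ι R := of fun l j => d k (g l j) + d j (g l k) - d l (g k j) with hY
      have e1 : christoffel d g k = (1 / 2 : ℝ) • (g⁻¹ * Y) := by
        ext i j; simp [christoffel, mul_apply, Y]
      rw [e1, Matrix.mul_smul, ← Matrix.mul_assoc, mul_nonsing_inv g hg, Matrix.one_mul]
      rfl
    have e2 : (christoffel d g k)ᵀ * g = (g * christoffel d g k)ᵀ := by rw [transpose_mul, hs]
    ext i j
    rw [e2, Matrix.add_apply, transpose_apply, e, e, ← smul_add, map_apply, hs.apply j k,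
      hs.apply i k, hs.apply i j]
    have : d k (g i j) + d i (g k j) - d j (g k i) + (d k (g i j) + d j (g k i) - d i (g k j))
        = (2 : ℝ) • d k (g i j) := by rw [two_smul]; ring
    rw [hs.apply j k, hs.apply i k] at *
    rw [this, smul_smul]
    norm_num

variable {Γ Γ' : ι → Matrix ι ι R} {g g' : Matrix ι ι R}

theorem IsLeviCivita.apply_det_metric (h : IsLeviCivita d Γ g) (k : ι) :
    d k g.det = 2 * g.det * trace (Γ k) := by
  rw [DiffAlg.apply_det, h.compat, Matrix.mul_add, trace_add, ← Matrix.mul_assoc,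
    ← Matrix.mul_assoc, adjugate_mul, trace_mul_comm, ← Matrix.mul_assoc, mul_adjugate]
  simp only [Matrix.smul_mul, Matrix.one_mul, trace_smul, trace_transpose, smul_eq_mul]
  ring

theorem IsLeviCivita.apply_density (h : IsLeviCivita d Γ g) {u : R} (hu : u ^ 4 = g.det ^ 2)
    (k : ι) : d k u = u * trace (Γ k) := by
  have hu0 : IsUnit (2 * (2 * u ^ 3)) := by
    have h2 : IsUnit (2 : R) := by
      have := (isUnit_iff_ne_zero.mpr (two_ne_zero (α := ℝ))).map (algebraMap ℝ R)
      rwa [map_ofNat] at this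
    refine h2.mul (h2.mul (IsUnit.pow 3 ?_))
    exact (isUnit_pow_iff (by norm_num : (4 : ℕ) ≠ 0)).mp (hu ▸ h.nondeg.pow 2)
  have e := congrArg (d k) hu
  rw [Derivation.leibniz_pow, Derivation.leibniz_pow, h.apply_det_metric] at e
  rw [← hu0.mul_right_inj]
  simp only [smul_eq_mul, nsmul_eq_mul] at e
  push_cast at e
  linear_combination e - 4 * trace (Γ k) * hu

theorem isSinjukov_of_projective (h : IsLeviCivita d Γ g) (h' : IsLeviCivita d Γ' g')
    {φ : ι → R} (hP : ∀ k, Γ' k = Γ k + (φ k • (1 : Matrix ι ι R) + vecMulVec (Pi.single k 1) φ))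
    {w : R} (hw : ∀ k, d k w = 2 * w * φ k) :
    IsSinjukov d Γ g (w • (g'⁻¹ * g)) (-(w • (g'⁻¹ *ᵥ φ))) where
  symm := by
    rw [IsSymm, Matrix.mul_smul, transpose_smul, transpose_mul, transpose_mul, h.symm,
      h'.inv_symm, Matrix.mul_assoc]
  cov k := by
    have e1 : covEnd d Γ k (g'⁻¹ * g) = -((Γ' k - Γ k) * (g'⁻¹ * g))
        - g'⁻¹ * ((Γ' k - Γ k)ᵀ * g) := by
      rw [covEnd, map_mul, h'.map_inv, h.compat, transpose_sub]
      noncomm_ring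
    have e2 : φ ᵥ* (g'⁻¹ * g) = g *ᵥ (g'⁻¹ *ᵥ φ) := by
      rw [← mulVec_transpose, transpose_mul, h.symm, h'.inv_symm, mulVec_mulVec]
    have e3 : (Pi.single k 1 : ι → R) ᵥ* g = g *ᵥ Pi.single k 1 := by
      rw [← mulVec_transpose, h.symm]
    have e4 : Γ' k - Γ k = φ k • (1 : Matrix ι ι R) + vecMulVec (Pi.single k 1) φ := by
      rw [hP]; abel
    rw [covEnd_smul, e1, hw, e4, transpose_add, transpose_smul, transpose_one,
      transpose_vecMulVec, Matrix.add_mul, Matrix.add_mul, Matrix.mul_add, vecMulVec_mul, e2,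
      vecMulVec_mul, e3, mul_vecMulVec]
    simp only [Matrix.smul_mul, Matrix.mul_smul, Matrix.one_mul, mulVec_neg, mulVec_smul,
      vecMulVec_neg, neg_vecMulVec, vecMulVec_smul, smul_vecMulVec]
    module

theorem IsSinjukov.const_sub (h : IsLeviCivita d Γ g) {L : Matrix ι ι R} {l : ι → R}
    (hL : IsSinjukov d Γ g L l) (t : ℝ) : IsSinjukov d Γ g (t • (1 : Matrix ι ι R) - L) (-l) where
  symm := by
    rw [Matrix.mul_sub, IsSymm, transpose_sub, hL.symm, Matrix.mul_smul, Matrix.mul_one,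
      transpose_smul, h.symm]
  cov k := by
    have e0 : ∀ T : Matrix ι ι R, covEnd d Γ k (t • (1 : Matrix ι ι R) - T) = -covEnd d Γ k T := by
      intro T
      have e : covEnd d Γ k (t • (1 : Matrix ι ι R)) = 0 := by
        rw [← algebraMap_smul R t (1 : Matrix ι ι R), covEnd_smul, covEnd_one,
          Derivation.map_algebraMap, zero_smul, smul_zero, add_zero]
      have := covEnd_add (d := d) (Γ := Γ) k (t • (1 : Matrix ι ι R) - T) T
      rw [sub_add_cancel, e] at this
      exact eq_neg_of_add_eq_zero_left this.symm
    rw [e0, hL.cov, mulVec_neg, vecMulVec_neg, neg_vecMulVec]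
    abel

/-- The operator `f ↦ u⁻¹ ∑ᵢⱼ ∂ᵢ(u Mⁱʲ ∂ⱼ f)`, with `u'` in the role of `u⁻¹`. -/
def assoc (d : ι → Derivation ℝ R R) (u' u : R) (M : Matrix ι ι R) (f : R) : R :=
  u' * ∑ i, ∑ j, d i (u * M i j * d j f)

theorem IsLeviCivita.assoc_eq (h : IsLeviCivita d Γ g) {u u' : R} (huu : u' * u = 1)
    (hu : ∀ k, d k u = u * trace (Γ k)) (M : Matrix ι ι R) (f : R) :
    assoc d u' u M f = divVec d Γ (M *ᵥ fun i => d i f) := by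
  rw [← one_mul (divVec d Γ _), ← huu, mul_assoc, h.divVec_eq hu, assoc]
  simp only [mulVec, dotProduct, Finset.mul_sum, map_sum, mul_assoc]

theorem commute_of_projective (hd : ∀ i j x, d i (d j x) = d j (d i x))
    (hs : g.IsSymm) (hg : IsUnit g.det) (hs' : g'.IsSymm) (hg' : IsUnit g'.det)
    {φ : ι → R} (hP : ∀ k, christoffel d g' k =
      christoffel d g k + (φ k • (1 : Matrix ι ι R) + vecMulVec (Pi.single k 1) φ))
    {u u' w : R} (huu : u' * u = 1) (hu : u ^ 4 = g.det ^ 2)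
    (hw : w ^ (2 * (Fintype.card ι + 1)) * g.det ^ 2 = g'.det ^ 2)
    {t : ℝ} (ht : IsUnit (t • (1 : Matrix ι ι R) - w • (g'⁻¹ * g)).det) (f : R) :
    assoc d u' u g⁻¹
        (assoc d u' u ((t • (1 : Matrix ι ι R) - w • (g'⁻¹ * g)).adjugate * g⁻¹) f) =
      assoc d u' u ((t • (1 : Matrix ι ι R) - w • (g'⁻¹ * g)).adjugate * g⁻¹)
        (assoc d u' u g⁻¹ f) := by
  have h := isLeviCivita_christoffel hd hs hg
  have h' := isLeviCivita_christoffel hd hs' hg'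
  have hun : IsUnit ((Fintype.card ι + 1 : ℕ) : R) := by
    have := (isUnit_iff_ne_zero.mpr (Nat.cast_add_one_ne_zero (R := ℝ) (Fintype.card ι))).map
      (algebraMap ℝ R)
    simpa using this
  have hutr := fun k => h.apply_density hu k
  have hwu : IsUnit w := by
    have : IsUnit (w ^ (2 * (Fintype.card ι + 1))) :=
      isUnit_of_mul_isUnit_left (hw ▸ hg'.pow 2)
    exact (isUnit_pow_iff (by omega)).mp this
  have hdw : ∀ k, d k w = 2 * w * φ k := by
    intro k
    have htr : trace (christoffel d g' k) =
        trace (christoffel d g k) + ((Fintype.card ι + 1 : ℕ) : R) * φ k := by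
      rw [hP]
      simp only [trace_add, trace_smul, trace_one, trace_vecMulVec, single_one_dotProduct,
        smul_eq_mul]
      push_cast
      ring
    have e := congrArg (d k) hw
    rw [Derivation.leibniz, Derivation.leibniz_pow, Derivation.leibniz_pow, Derivation.leibniz_pow,
      h.apply_det_metric, h'.apply_det_metric, htr] at e
    have e1 : w ^ (2 * (Fintype.card ι + 1)) = w ^ (2 * (Fintype.card ι + 1) - 1) * w := by
      rw [← pow_succ]; congr 1
    rw [← ((hun.mul (hwu.pow (2 * (Fintype.card ι + 1) - 1))).mul (hg.pow 2)).mul_right_inj]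
    apply two_mul_inj
    rw [e1] at e hw
    generalize trace (christoffel d g k) = τ at e
    generalize w ^ (2 * (Fintype.card ι + 1) - 1) = W at *
    simp only [smul_eq_mul, nsmul_eq_mul] at e
    push_cast at e ⊢
    linear_combination e - 4 * (τ + ((Fintype.card ι : R) + 1) * φ k) * hw
  have hA := (isSinjukov_of_projective h h' hP hdw).const_sub h t
  have hu0 : IsUnit u := isUnit_iff_exists_inv'.mpr ⟨u', huu⟩
  simp only [h.assoc_eq huu hutr]
  exact hA.commute h ht hu0 hutr f

end Projective
end DiffAlg

section Smooth

variable {n : ℕ} {U : Set (Fin n → ℝ)}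

theorem ContDiffOn.pd (hU : IsOpen U) {f : (Fin n → ℝ) → ℝ} (hf : ContDiffOn ℝ (⊤ : ℕ∞) f U)
    (i : Fin n) : ContDiffOn ℝ (⊤ : ℕ∞) (pd i f) U :=
  (hf.fderiv_of_isOpen hU (by exact_mod_cast le_top)).clm_apply contDiffOn_const

theorem ContDiffOn.matrix_det {E ι : Type*} [NormedAddCommGroup E] [NormedSpace ℝ E] [Fintype ι]
    [DecidableEq ι] {s : Set E} {m : WithTop ℕ∞} {M : E → Matrix ι ι ℝ}
    (hM : ∀ i j, ContDiffOn ℝ m (fun x => M x i j) s) :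
    ContDiffOn ℝ m (fun x => (M x).det) s := by
  simp only [det_apply]
  exact ContDiffOn.sum fun σ _ => ContDiffOn.const_smul _ (contDiffOn_prod fun i _ => hM _ _)

theorem ContDiffOn.matrix_adjugate {E ι : Type*} [NormedAddCommGroup E] [NormedSpace ℝ E]
    [Fintype ι] [DecidableEq ι] {s : Set E} {m : WithTop ℕ∞} {M : E → Matrix ι ι ℝ}
    (hM : ∀ i j, ContDiffOn ℝ m (fun x => M x i j) s) (i j : ι) :
    ContDiffOn ℝ m (fun x => (M x).adjugate i j) s := by
  simp only [adjugate_apply]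
  refine ContDiffOn.matrix_det fun a b => ?_
  by_cases h : a = j
  · subst h
    simpa using contDiffOn_const
  · simpa [updateRow_ne h] using hM a b

theorem ContDiffOn.matrix_inv {E ι : Type*} [NormedAddCommGroup E] [NormedSpace ℝ E]
    [Fintype ι] [DecidableEq ι] {s : Set E} {m : WithTop ℕ∞} {M : E → Matrix ι ι ℝ}
    (hM : ∀ i j, ContDiffOn ℝ m (fun x => M x i j) s) (hdet : ∀ x ∈ s, IsUnit (M x).det) (i j : ι) :
    ContDiffOn ℝ m (fun x => (M x)⁻¹ i j) s := by
  simp only [inv_def, Ring.inverse_eq_inv', Matrix.smul_apply, smul_eq_mul]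
  exact ((ContDiffOn.matrix_det hM).inv fun x hx => (hdet x hx).ne_zero).mul
    (ContDiffOn.matrix_adjugate hM i j)

theorem IsMetricOn.contDiffOn_Gamma (hU : IsOpen U) {g : (Fin n → ℝ) → Matrix (Fin n) (Fin n) ℝ}
    (hg : IsMetricOn U g) (k i j : Fin n) : ContDiffOn ℝ (⊤ : ℕ∞) (Gamma g k i j) U := by
  refine contDiffOn_const.mul (ContDiffOn.sum fun l _ => ?_)
  refine (ContDiffOn.matrix_inv hg.smooth hg.nondeg k l).mul ?_
  exact (((hg.smooth _ _).pd hU i).add ((hg.smooth _ _).pd hU j)).sub ((hg.smooth _ _).pd hU l)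

theorem IsMetricOn.Gamma_symm {g : (Fin n → ℝ) → Matrix (Fin n) (Fin n) ℝ} (hU : IsOpen U)
    (hg : IsMetricOn U g) {x : Fin n → ℝ} (hx : x ∈ U) (k i j : Fin n) :
    Gamma g k i j x = Gamma g k j i x := by
  have : ∀ l, pd l (fun y => g y i j) x = pd l (fun y => g y j i) x := by
    intro l
    have : (fun y => g y i j) =ᶠ[nhds x] fun y => g y j i := by
      filter_upwards [hU.mem_nhds hx] with y hy using (hg.symm y hy).apply j i
    simp only [pd, this.fderiv_eq]
  simp only [Gamma, this]
  congr 1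
  exact Finset.sum_congr rfl fun l _ => by ring

/-- Local existence of smooth integral curves of a smooth vector field on an open set. -/
theorem exists_smooth_integralCurve {E : Type*} [NormedAddCommGroup E] [NormedSpace ℝ E]
    [CompleteSpace E] {F : E → E} {W : Set E} (hW : IsOpen W) (hF : ContDiffOn ℝ (⊤ : ℕ∞) F W)
    {y : E} (hy : y ∈ W) : ∃ (α : ℝ → E) (ε : ℝ), 0 < ε ∧ α 0 = y ∧
      ContDiffOn ℝ (⊤ : ℕ∞) α (Set.Ioo (-ε) ε) ∧
      ∀ t ∈ Set.Ioo (-ε) ε, α t ∈ W ∧ HasDerivAt α (F (α t)) t := by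
  have h1 : ContDiffAt ℝ 1 F y :=
    (hF.contDiffAt (hW.mem_nhds hy)).of_le (by exact_mod_cast le_top)
  obtain ⟨α, h0, ε, hε, hα⟩ :=
    h1.exists_forall_mem_closedBall_exists_eq_forall_mem_Ioo_hasDerivAt₀ 0
  simp only [zero_sub, zero_add] at hα
  have hc : ContinuousAt α 0 := (hα 0 ⟨by linarith, hε⟩).continuousAt
  have hn : α ⁻¹' W ∈ nhds (0 : ℝ) := hc (hW.mem_nhds (h0 ▸ hy))
  obtain ⟨δ, hδ, hball⟩ := Metric.mem_nhds_iff.mp hn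
  set r := min (ε / 2) (δ / 2) with hr
  have hr0 : 0 < r := by positivity
  have hrε : r < ε := (min_le_left _ _).trans_lt (by linarith)
  have hrδ : r < δ := (min_le_right _ _).trans_lt (by linarith)
  have hI : ∀ t ∈ Set.Icc (-r) r, α t ∈ W ∧ HasDerivAt α (F (α t)) t := by
    intro t ht
    refine ⟨hball ?_, hα t ⟨by linarith [ht.1], by linarith [ht.2]⟩⟩
    rw [Metric.mem_ball, dist_zero_right, Real.norm_eq_abs, abs_lt]
    exact ⟨by linarith [ht.1], by linarith [ht.2]⟩
  have hsm : ContDiffOn ℝ ((⊤ : ℕ∞) : WithTop ℕ∞) α (Set.Icc (-r) r) :=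
    ODE.contDiffOn_enat_Icc_of_hasDerivWithinAt (f := fun _ z => F z) (u := W)
      (hF.comp contDiffOn_snd fun p hp => hp.2)
      (fun t ht => (hI t ht).2.hasDerivWithinAt) (fun t ht => (hI t ht).1)
  exact ⟨α, r, hr0, h0, hsm.mono Set.Ioo_subset_Icc_self,
    fun t ht => hI t (Set.Ioo_subset_Icc_self ht)⟩

theorem IsMetricOn.exists_geodesic (hU : IsOpen U) {g : (Fin n → ℝ) → Matrix (Fin n) (Fin n) ℝ}
    (hg : IsMetricOn U g) {x : Fin n → ℝ} (hx : x ∈ U) {v : Fin n → ℝ} (hv : v ≠ 0) :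
    ∃ (γ : ℝ → Fin n → ℝ) (I : Set ℝ), IsGeodesicOn U g γ I ∧ (0 : ℝ) ∈ I ∧ γ 0 = x ∧
      (∀ k, deriv (fun s => γ s k) 0 = v k) ∧ ∀ t ∈ I, ∃ k, deriv (fun s => γ s k) t ≠ 0 := by
  set F : (Fin n → ℝ) × (Fin n → ℝ) → (Fin n → ℝ) × (Fin n → ℝ) :=
    fun p => (p.2, fun k => -∑ i, ∑ j, Gamma g k i j p.1 * p.2 i * p.2 j) with hFdef
  set W : Set ((Fin n → ℝ) × (Fin n → ℝ)) := U ×ˢ {0}ᶜ with hWdef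
  have hW : IsOpen W := hU.prod isOpen_compl_singleton
  have hsnd : ∀ i, ContDiffOn ℝ (⊤ : ℕ∞) (fun p : (Fin n → ℝ) × (Fin n → ℝ) => p.2 i) W :=
    fun i => ((contDiff_apply ℝ ℝ i).comp contDiff_snd).contDiffOn
  have hF : ContDiffOn ℝ (⊤ : ℕ∞) F W := by
    refine contDiffOn_snd.prodMk (contDiffOn_pi.mpr fun k => ?_)
    refine (ContDiffOn.sum fun i _ => ContDiffOn.sum fun j _ => ?_).neg
    exact (((hg.contDiffOn_Gamma hU k i j).comp contDiffOn_fst fun p hp => hp.1).mul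
      (hsnd i)).mul (hsnd j)
  obtain ⟨α, ε, hε, h0, hsm, hα⟩ := exists_smooth_integralCurve hW hF (y := (x, v)) ⟨hx, hv⟩
  have hd1 : ∀ t ∈ Set.Ioo (-ε) ε, ∀ k, HasDerivAt (fun s => (α s).1 k) ((α t).2 k) t := by
    intro t ht k
    exact hasDerivAt_pi.mp (hα t ht).2.fst k
  have hd2 : ∀ t ∈ Set.Ioo (-ε) ε, ∀ k, HasDerivAt (fun s => (α s).2 k)
      (-∑ i, ∑ j, Gamma g k i j (α t).1 * (α t).2 i * (α t).2 j) t := by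
    intro t ht k
    exact hasDerivAt_pi.mp (hα t ht).2.snd k
  have hm : (0 : ℝ) ∈ Set.Ioo (-ε) ε := ⟨by linarith, hε⟩
  refine ⟨fun s => (α s).1, Set.Ioo (-ε) ε, ⟨⟨isOpen_Ioo, Set.ordConnected_Ioo⟩, fun k => ?_,
    fun t ht => (hα t ht).1.1, fun t ht k => ?_⟩, hm, congrArg Prod.fst h0, fun k => ?_, fun t ht => ?_⟩
  · exact (contDiff_apply ℝ ℝ k).comp_contDiffOn (contDiff_fst.comp_contDiffOn hsm)
  · have e : deriv (fun s => (α s).1 k) =ᶠ[nhds t] fun s => (α s).2 k := by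
      filter_upwards [isOpen_Ioo.mem_nhds ht] with s hs using (hd1 s hs k).deriv
    rw [e.deriv_eq, (hd2 t ht k).deriv]
    simp only [(hd1 t ht _).deriv]
    ring
  · rw [(hd1 0 hm k).deriv, h0]
  · have h2 : (α t).2 ≠ 0 := (hα t ht).1.2
    obtain ⟨k, hk⟩ := Function.ne_iff.mp h2
    exact ⟨k, by rw [(hd1 t ht k).deriv]; exact hk⟩

theorem ProjEquiv.exists_Gamma_sub (hU : IsOpen U)
    {g g' : (Fin n → ℝ) → Matrix (Fin n) (Fin n) ℝ} (hg : IsMetricOn U g)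
    (h : ProjEquiv U g g') {x : Fin n → ℝ} (hx : x ∈ U) (v : Fin n → ℝ) :
    ∃ c : ℝ, ∀ k, ∑ i, ∑ j, (Gamma g' k i j x - Gamma g k i j x) * v i * v j = c * v k := by
  by_cases hv : v = 0
  · exact ⟨0, by simp [hv]⟩
  obtain ⟨γ, I, hγ, h0, hγ0, hγ', hne⟩ := hg.exists_geodesic hU hx hv
  obtain ⟨φ, J, hJ, hφ, -, him, hφ', hγφ⟩ := h γ I hγ hne
  obtain ⟨s, hs, hs0⟩ : (0 : ℝ) ∈ φ '' J := him ▸ h0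
  have hφd : ∀ r ∈ J, DifferentiableAt ℝ φ r := fun r hr =>
    (hφ.contDiffAt (hJ.1.mem_nhds hr)).differentiableAt (by simp)
  have hφdd : DifferentiableAt ℝ (deriv φ) s :=
    ((hφ.deriv_of_isOpen hJ.1 (m := (⊤ : ℕ∞)) (by exact_mod_cast le_top)).contDiffAt
      (hJ.1.mem_nhds hs)).differentiableAt (by simp)
  have hI : IsOpen I := hγ.interval.1
  have hγd : ∀ r ∈ I, ∀ k, DifferentiableAt ℝ (fun s => γ s k) r := fun r hr k =>
    ((hγ.smooth k).contDiffAt (hI.mem_nhds hr)).differentiableAt (by simp)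
  have hγdd : ∀ k, DifferentiableAt ℝ (deriv fun s => γ s k) (φ s) := fun k =>
    (((hγ.smooth k).deriv_of_isOpen hI (m := (⊤ : ℕ∞)) (by exact_mod_cast le_top)).contDiffAt
      (hI.mem_nhds (hs0 ▸ h0))).differentiableAt (by simp)
  have hmem : ∀ r ∈ J, φ r ∈ I := fun r hr => him ▸ Set.mem_image_of_mem φ hr
  have d1 : ∀ r ∈ J, ∀ k, deriv (fun s => (γ ∘ φ) s k) r =
      deriv (fun s => γ s k) (φ r) * deriv φ r := fun r hr k =>
    ((hγd (φ r) (hmem r hr) k).hasDerivAt.comp r (hφd r hr).hasDerivAt).deriv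
  have d2 : ∀ k, deriv (deriv fun s => (γ ∘ φ) s k) s =
      deriv (deriv fun s => γ s k) (φ s) * deriv φ s * deriv φ s
        + deriv (fun s => γ s k) (φ s) * deriv (deriv φ) s := by
    intro k
    have e : (deriv fun s => (γ ∘ φ) s k) =ᶠ[nhds s]
        fun r => deriv (fun s => γ s k) (φ r) * deriv φ r := by
      filter_upwards [hJ.1.mem_nhds hs] with r hr using d1 r hr k
    rw [e.deriv_eq]
    exact (((hγdd k).hasDerivAt.comp s (hφd s hs).hasDerivAt).mul hφdd.hasDerivAt).deriv
  refine ⟨-deriv (deriv φ) s / (deriv φ s) ^ 2, fun k => ?_⟩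
  have e1 := hγ.eqn 0 h0 k
  have e2 := hγφ.eqn s hs k
  rw [d2] at e2
  simp only [d1 s hs] at e2
  simp only [Function.comp_apply, hs0, hγ0, hγ'] at e1 e2
  have hne0 : deriv φ s ≠ 0 := hφ' s hs
  have e3 : ∑ i, ∑ j, Gamma g' k i j x * (v i * deriv φ s) * (v j * deriv φ s) =
      (∑ i, ∑ j, Gamma g' k i j x * v i * v j) * deriv φ s ^ 2 := by
    simp only [Finset.sum_mul]
    exact Finset.sum_congr rfl fun i _ => Finset.sum_congr rfl fun j _ => by ring
  rw [e3] at e2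
  simp only [sub_mul, Finset.sum_sub_distrib]
  field_simp
  linear_combination e2 - deriv φ s ^ 2 * e1

end Smooth

namespace DiffAlg

/-- Symmetric bilinear vector-valued maps whose value on the diagonal is proportional to the
argument. -/
theorem symbol_of_diagonal {n : ℕ} {P : Fin n → Matrix (Fin n) (Fin n) ℝ} (hs : ∀ k, (P k).IsSymm)
    (h : ∀ v : Fin n → ℝ, ∃ c : ℝ, ∀ k, v ⬝ᵥ P k *ᵥ v = c * v k) (k i j : Fin n) :
    ((n : ℝ) + 1) * P k i j =
      (∑ m, P m m i) * (if k = j then 1 else 0) + (∑ m, P m m j) * (if k = i then 1 else 0) := by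
  have hB : ∀ k (a b : Fin n → ℝ), b ⬝ᵥ P k *ᵥ a = a ⬝ᵥ P k *ᵥ b := by
    intro k a b
    rw [dotProduct_mulVec, ← mulVec_transpose, hs, dotProduct_comm]
  have hq : ∀ k l (v : Fin n → ℝ), (v ⬝ᵥ P k *ᵥ v) * v l = (v ⬝ᵥ P l *ᵥ v) * v k := by
    intro k l v
    obtain ⟨c, hc⟩ := h v
    rw [hc, hc]; ring
  have hpol : ∀ k l (a b c : Fin n → ℝ),
      (a ⬝ᵥ P k *ᵥ b) * c l + (b ⬝ᵥ P k *ᵥ c) * a l + (a ⬝ᵥ P k *ᵥ c) * b l =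
      (a ⬝ᵥ P l *ᵥ b) * c k + (b ⬝ᵥ P l *ᵥ c) * a k + (a ⬝ᵥ P l *ᵥ c) * b k := by
    intro k l a b c
    have h1 := hq k l (a + b + c)
    have h2 := hq k l (a + b)
    have h3 := hq k l (b + c)
    have h4 := hq k l (a + c)
    have h5 := hq k l a
    have h6 := hq k l b
    have h7 := hq k l c
    simp only [add_dotProduct, mulVec_add, dotProduct_add, Pi.add_apply, hB _ a b, hB _ b c,
      hB _ a c] at h1 h2 h3 h4
    linear_combination (h1 - h2 - h3 - h4 + h5 + h6 + h7) / 2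
  have hent : ∀ k i j, (Pi.single i 1 : Fin n → ℝ) ⬝ᵥ P k *ᵥ Pi.single j 1 = P k i j := by
    intro k i j; simp
  have hsum : ∀ m, P k i j + P k j m * (if m = i then 1 else 0)
      + P k i m * (if m = j then 1 else 0) =
      P m i j * (if k = m then 1 else 0) + P m m j * (if k = i then 1 else 0)
        + P m m i * (if k = j then (1 : ℝ) else 0) := by
    intro m
    have := hpol k m (Pi.single i 1) (Pi.single j 1) (Pi.single m 1)
    simp only [hent, Pi.single_apply] at this
    rw [(hs m).apply m j, (hs m).apply m i, if_pos trivial, mul_one] at this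
    exact this
  have := Finset.sum_congr (rfl : (Finset.univ : Finset (Fin n)) = _) fun m _ => hsum m
  simp only [Finset.sum_add_distrib, if_true, mul_one, Finset.sum_const, Finset.card_univ,
    Fintype.card_fin, nsmul_eq_mul, mul_ite, mul_zero, Finset.sum_ite_eq, Finset.sum_ite_eq',
    Finset.mem_univ, (hs k).apply i j] at this
  have e : ∀ (p : Prop) [Decidable p] (a : Fin n → ℝ),
      (∑ m, if p then a m else 0) = (∑ m, a m) * if p then 1 else 0 := by
    intro p _ a; split_ifs <;> simp
  rw [e, e] at this
  linear_combination this

section SmoothFunctions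

variable {n : ℕ}

/-- The algebra of functions on `V` that are restrictions of functions smooth on `V`. -/
def smoothAlg (V : Set (Fin n → ℝ)) : Subalgebra ℝ (V → ℝ) where
  carrier := {F | ∃ f : (Fin n → ℝ) → ℝ, ContDiffOn ℝ (⊤ : ℕ∞) f V ∧ ∀ x : V, F x = f x}
  mul_mem' := by
    rintro F G ⟨f, hf, hF⟩ ⟨g, hg, hG⟩
    exact ⟨fun x => f x * g x, hf.mul hg, fun x => by rw [Pi.mul_apply, hF, hG]⟩
  add_mem' := by
    rintro F G ⟨f, hf, hF⟩ ⟨g, hg, hG⟩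
    exact ⟨fun x => f x + g x, hf.add hg, fun x => by rw [Pi.add_apply, hF, hG]⟩
  algebraMap_mem' r := ⟨fun _ => r, contDiffOn_const, fun _ => rfl⟩

variable {V : Set (Fin n → ℝ)}

/-- The element `F` of `smoothAlg V` is the restriction of `f`. -/
def Represents (F : smoothAlg V) (f : (Fin n → ℝ) → ℝ) : Prop := ∀ x : V, F.1 x = f x

/-- The restriction of a function smooth on `V`, as an element of `smoothAlg V`. -/
def restrict (f : (Fin n → ℝ) → ℝ) (hf : ContDiffOn ℝ (⊤ : ℕ∞) f V) : smoothAlg V :=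
  ⟨fun x => f x, f, hf, fun _ => rfl⟩

theorem represents_restrict (f : (Fin n → ℝ) → ℝ) (hf : ContDiffOn ℝ (⊤ : ℕ∞) f V) :
    Represents (restrict f hf) f := fun _ => rfl

theorem pd_congr (hV : IsOpen V) {f h : (Fin n → ℝ) → ℝ} (hfh : ∀ x : V, f x = h x) (i : Fin n)
    (x : V) : pd i f x = pd i h x := by
  have : f =ᶠ[nhds (x : Fin n → ℝ)] h := by
    filter_upwards [hV.mem_nhds x.2] with y hy using hfh ⟨y, hy⟩
  rw [pd, pd, this.fderiv_eq]

theorem contDiffOn_differentiableAt (hV : IsOpen V) {f : (Fin n → ℝ) → ℝ}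
    (hf : ContDiffOn ℝ (⊤ : ℕ∞) f V) (x : V) : DifferentiableAt ℝ f x :=
  (hf.contDiffAt (hV.mem_nhds x.2)).differentiableAt (by simp)

/-- A function smooth on `V` whose restriction is `F`. -/
noncomputable def repr (F : smoothAlg V) : (Fin n → ℝ) → ℝ := F.2.choose

theorem repr_smooth (F : smoothAlg V) : ContDiffOn ℝ (⊤ : ℕ∞) (repr F) V := F.2.choose_spec.1

theorem represents_repr (F : smoothAlg V) : Represents F (repr F) := F.2.choose_spec.2

/-- Partial derivatives as derivations of `smoothAlg V`. -/
noncomputable def pderiv (hV : IsOpen V) (i : Fin n) : Derivation ℝ (smoothAlg V) (smoothAlg V) :=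
  Derivation.mk'
    { toFun := fun F => restrict (pd i (repr F)) ((repr_smooth F).pd hV i)
      map_add' := fun F G => by
        ext x
        change pd i (repr (F + G)) x = pd i (repr F) x + pd i (repr G) x
        rw [pd_congr hV (h := fun y => repr F y + repr G y)
          fun y => by rw [← represents_repr, ← represents_repr, ← represents_repr]; rfl]
        have hF := contDiffOn_differentiableAt hV (repr_smooth F) x
        have hG := contDiffOn_differentiableAt hV (repr_smooth G) x
        simp only [pd, fderiv_fun_add hF hG]
        rfl
      map_smul' := fun r F => by
        ext x
        change pd i (repr (r • F)) x = r * pd i (repr F) x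
        rw [pd_congr hV (h := fun y => r * repr F y)
          fun y => by rw [← represents_repr, ← represents_repr]; rfl]
        have hF := contDiffOn_differentiableAt hV (repr_smooth F) x
        simp only [pd, fderiv_const_mul hF]
        rfl }
    fun F G => by
      ext x
      change pd i (repr (F * G)) x = F.1 x * pd i (repr G) x + G.1 x * pd i (repr F) x
      rw [pd_congr hV (h := fun y => repr F y * repr G y)
          fun y => by rw [← represents_repr, ← represents_repr, ← represents_repr]; rfl]
      have hF := contDiffOn_differentiableAt hV (repr_smooth F) x
      have hG := contDiffOn_differentiableAt hV (repr_smooth G) x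
      simp only [pd, fderiv_fun_mul hF hG, represents_repr F x, represents_repr G x]
      rfl

theorem Represents.pderiv {F : smoothAlg V} {f : (Fin n → ℝ) → ℝ} (hF : Represents F f)
    (hV : IsOpen V) (i : Fin n) : Represents (pderiv hV i F) (pd i f) := fun x =>
  pd_congr hV (fun y => by rw [← represents_repr, hF]) i x

theorem pderiv_comm (hV : IsOpen V) (i j : Fin n) (F : smoothAlg V) :
    pderiv hV i (pderiv hV j F) = pderiv hV j (pderiv hV i F) := by
  ext x
  rw [((represents_repr F).pderiv hV j).pderiv hV i x,
    ((represents_repr F).pderiv hV i).pderiv hV j x]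
  have hc : ContDiffAt ℝ (⊤ : ℕ∞) (repr F) x := (repr_smooth F).contDiffAt (hV.mem_nhds x.2)
  have hs : IsSymmSndFDerivAt ℝ (repr F) x := hc.isSymmSndFDerivAt (by
    rw [minSmoothness_of_isRCLikeNormedField]; exact WithTop.coe_le_coe.mpr (le_top : (2 : ℕ∞) ≤ ⊤))
  have hd : DifferentiableAt ℝ (fderiv ℝ (repr F)) x :=
    (hc.fderiv_right (m := (⊤ : ℕ∞)) (by exact_mod_cast le_top)).differentiableAt (by simp)
  have e : ∀ i j : Fin n, pd i (pd j (repr F)) x =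
      fderiv ℝ (fderiv ℝ (repr F)) x (Pi.single i 1) (Pi.single j 1) := by
    intro i j
    unfold pd
    rw [fderiv_clm_apply hd (differentiableAt_const _)]
    simp
  rw [e, e, hs]

theorem Represents.mul {F G : smoothAlg V} {f g : (Fin n → ℝ) → ℝ} (hF : Represents F f)
    (hG : Represents G g) : Represents (F * G) fun x => f x * g x := fun x => by
  change F.1 x * G.1 x = f x * g x
  rw [hF, hG]

theorem Represents.add {F G : smoothAlg V} {f g : (Fin n → ℝ) → ℝ} (hF : Represents F f)
    (hG : Represents G g) : Represents (F + G) fun x => f x + g x := fun x => by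
  change F.1 x + G.1 x = f x + g x
  rw [hF, hG]

theorem Represents.sub {F G : smoothAlg V} {f g : (Fin n → ℝ) → ℝ} (hF : Represents F f)
    (hG : Represents G g) : Represents (F - G) fun x => f x - g x := fun x => by
  change F.1 x - G.1 x = f x - g x
  rw [hF, hG]

theorem Represents.smul {F : smoothAlg V} {f : (Fin n → ℝ) → ℝ} (hF : Represents F f) (r : ℝ) :
    Represents (r • F) fun x => r * f x := fun x => by
  change r * F.1 x = r * f x
  rw [hF]

theorem represents_sum {κ : Type*} (s : Finset κ) {F : κ → smoothAlg V}
    {f : κ → (Fin n → ℝ) → ℝ} (hF : ∀ k, Represents (F k) (f k)) :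
    Represents (∑ k ∈ s, F k) fun x => ∑ k ∈ s, f k x := fun x => by
  simpa using Finset.sum_congr rfl fun k _ => hF k x

theorem isUnit_of_ne_zero {F : smoothAlg V} (hF : ∀ x, F.1 x ≠ 0) : IsUnit F := by
  refine isUnit_iff_exists_inv.mpr ⟨restrict (fun y => (repr F y)⁻¹)
    ((repr_smooth F).inv fun x hx => ?_), ?_⟩
  · rw [← represents_repr F ⟨x, hx⟩]; exact hF _
  · ext x
    change F.1 x * (repr F x)⁻¹ = 1
    rw [← represents_repr F x, mul_inv_cancel₀ (hF x)]

/-- Evaluation at a point of `V`. -/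
def evalAt (x : V) : smoothAlg V →+* ℝ :=
  (Pi.evalRingHom (fun _ : V => ℝ) x).comp (smoothAlg V).val.toRingHom

theorem evalAt_apply (x : V) (F : smoothAlg V) : evalAt x F = F.1 x := rfl

theorem matrix_ext_evalAt {M N : Matrix (Fin n) (Fin n) (smoothAlg V)}
    (h : ∀ x : V, M.map (evalAt x) = N.map (evalAt x)) : M = N := by
  ext i j x
  exact congrFun (congrFun (h x) i) j

theorem isUnit_det_of_evalAt {M : Matrix (Fin n) (Fin n) (smoothAlg V)}
    (h : ∀ x : V, IsUnit (M.map (evalAt x)).det) : IsUnit M.det := by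
  refine isUnit_of_ne_zero fun x => ?_
  rw [← evalAt_apply, RingHom.map_det]
  exact (h x).ne_zero

theorem map_evalAt_inv {M : Matrix (Fin n) (Fin n) (smoothAlg V)} (h : IsUnit M.det) (x : V) :
    M⁻¹.map (evalAt x) = (M.map (evalAt x))⁻¹ := by
  refine (inv_eq_right_inv ?_).symm
  rw [← Matrix.map_mul, mul_nonsing_inv M h, Matrix.map_one _ (map_zero _) (map_one _)]

theorem Represents.assoc (hV : IsOpen V) {g A : (Fin n → ℝ) → Matrix (Fin n) (Fin n) ℝ}
    {u' u F : smoothAlg V} {M : Matrix (Fin n) (Fin n) (smoothAlg V)} {f : (Fin n → ℝ) → ℝ}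
    (hu' : Represents u' fun x => |(g x).det| ^ (-(1 : ℝ) / 2))
    (hu : Represents u fun x => |(g x).det| ^ ((1 : ℝ) / 2))
    (hM : ∀ i j, Represents (M i j) fun x => A x i j) (hF : Represents F f) :
    Represents (assoc (DiffAlg.pderiv hV) u' u M F) (assocOp g A f) :=
  hu'.mul (represents_sum _ fun i => represents_sum _ fun j =>
    ((hu.mul (hM i j)).mul (hF.pderiv hV j)).pderiv hV i)

/-- A matrix field smooth on `V`, as a matrix over `smoothAlg V`. -/
def restrictMatrix (M : (Fin n → ℝ) → Matrix (Fin n) (Fin n) ℝ)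
    (hM : ∀ i j, ContDiffOn ℝ (⊤ : ℕ∞) (fun x => M x i j) V) :
    Matrix (Fin n) (Fin n) (smoothAlg V) :=
  of fun i j => restrict _ (hM i j)

theorem evalAt_christoffel (hV : IsOpen V) {g : (Fin n → ℝ) → Matrix (Fin n) (Fin n) ℝ}
    (hg : IsMetricOn V g) (k i j : Fin n) (x : V) :
    evalAt x (christoffel (pderiv hV) (restrictMatrix g hg.smooth) k i j) = Gamma g i k j x := by
  have hdet : IsUnit (restrictMatrix g hg.smooth).det :=
    isUnit_det_of_evalAt fun x => hg.nondeg x x.2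
  have hr : ∀ a b, Represents (restrictMatrix g hg.smooth a b) fun x => g x a b :=
    fun _ _ _ => rfl
  have hinv : ∀ a b, Represents ((restrictMatrix g hg.smooth)⁻¹ a b) fun x => (g x)⁻¹ a b :=
    fun a b x => congrFun (congrFun (map_evalAt_inv hdet x) a) b
  exact (represents_sum _ fun l => (hinv i l).mul
    ((((hr l j).pderiv hV k).add ((hr l k).pderiv hV j)).sub ((hr k j).pderiv hV l))).smul
      (1 / 2) x

end SmoothFunctions

section Interpolation

/-- Lagrange interpolation of the adjugate of a matrix pencil. -/
theorem adjugate_eq_sum {n : ℕ} (s : Finset ℝ) (hs : n < s.card) (t : ℝ)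
    (M : Matrix (Fin n) (Fin n) ℝ) :
    (t • (1 : Matrix (Fin n) (Fin n) ℝ) - M).adjugate =
      ∑ τ ∈ s, (Lagrange.basis s id τ).eval t •
        (τ • (1 : Matrix (Fin n) (Fin n) ℝ) - M).adjugate := by
  ext i j
  set A : Matrix (Fin n) (Fin n) ℝ := updateRow 1 j 0 with hA
  set B : Matrix (Fin n) (Fin n) ℝ := updateRow (-M) j (Pi.single i 1) with hB
  set p : Polynomial ℝ :=
    det ((Polynomial.X : Polynomial ℝ) • A.map Polynomial.C + B.map Polynomial.C) with hp
  have hdeg : p.degree < s.card := by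
    refine (Polynomial.degree_le_natDegree).trans_lt ?_
    have := Polynomial.natDegree_det_X_add_C_le A B
    rw [Fintype.card_fin] at this
    exact_mod_cast this.trans_lt hs
  have hev : ∀ τ, p.eval τ = (τ • (1 : Matrix (Fin n) (Fin n) ℝ) - M).adjugate i j := by
    intro τ
    rw [adjugate_apply, hp, ← Polynomial.coe_evalRingHom, RingHom.map_det]
    congr 1
    ext a b
    by_cases h : a = j
    · subst h; simp [A, B]
    · simp [A, B, updateRow_ne h, one_apply, sub_eq_add_neg]
      split_ifs <;> simp
  have key := Lagrange.eq_interpolate (s := s) (v := id) (f := p)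
    Function.injective_id.injOn hdeg
  rw [← hev, key, Lagrange.interpolate_apply, Polynomial.eval_finsetSum, Matrix.sum_apply]
  refine Finset.sum_congr rfl fun τ _ => ?_
  rw [Polynomial.eval_mul, Polynomial.eval_C, Matrix.smul_apply, ← hev, smul_eq_mul, mul_comm]
  rfl

end Interpolation

section Main

variable {n : ℕ}

theorem evalAt_smul {V : Set (Fin n → ℝ)} (x : V) (r : ℝ) (F : smoothAlg V) :
    evalAt x (r • F) = r * evalAt x F := rfl

theorem map_evalAt_smul_one_sub {V : Set (Fin n → ℝ)} (x : V) (r : ℝ)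
    (M : Matrix (Fin n) (Fin n) (smoothAlg V)) :
    (r • (1 : Matrix (Fin n) (Fin n) (smoothAlg V)) - M).map (evalAt x) =
      r • (1 : Matrix (Fin n) (Fin n) ℝ) - M.map (evalAt x) := by
  ext i j
  simp only [map_apply, Matrix.sub_apply, Matrix.smul_apply, map_sub, evalAt_smul, one_apply]
  split_ifs <;> simp

theorem christoffel_sub_eq {V : Set (Fin n → ℝ)} (hV : IsOpen V)
    {g gbar : (Fin n → ℝ) → Matrix (Fin n) (Fin n) ℝ}
    (hg : IsMetricOn V g) (hgbar : IsMetricOn V gbar)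
    (hP : ∀ x ∈ V, ∀ v : Fin n → ℝ, ∃ c : ℝ, ∀ k, ∑ i, ∑ j,
      (Gamma gbar k i j x - Gamma g k i j x) * v i * v j = c * v k) :
    ∃ φ : Fin n → smoothAlg V, ∀ k,
      christoffel (pderiv hV) (restrictMatrix gbar hgbar.smooth) k =
        christoffel (pderiv hV) (restrictMatrix g hg.smooth) k +
          (φ k • (1 : Matrix (Fin n) (Fin n) (smoothAlg V)) + vecMulVec (Pi.single k 1) φ) := by
  set C := christoffel (pderiv hV) (restrictMatrix g hg.smooth) with hC
  set C' := christoffel (pderiv hV) (restrictMatrix gbar hgbar.smooth) with hC'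
  refine ⟨fun k => ((n : ℝ) + 1)⁻¹ • ((C' k).trace - (C k).trace), fun k => ?_⟩
  refine matrix_ext_evalAt fun x => ?_
  ext i j
  have key := symbol_of_diagonal
    (P := fun m => of fun i j => Gamma gbar m i j x - Gamma g m i j x)
    (fun m => by
      ext a b
      simp [hgbar.Gamma_symm hV x.2 m a b, hg.Gamma_symm hV x.2 m a b])
    (fun v => by
      obtain ⟨c, hc⟩ := hP x x.2 v
      refine ⟨c, fun k => ?_⟩
      rw [← hc k]
      simp only [dotProduct, mulVec, of_apply, Finset.mul_sum]
      exact Finset.sum_congr rfl fun a _ => Finset.sum_congr rfl fun b _ => by ring) i k j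
  have hφ : ∀ k, evalAt x (((n : ℝ) + 1)⁻¹ • ((C' k).trace - (C k).trace)) =
      ((n : ℝ) + 1)⁻¹ * ∑ m, (Gamma gbar m m k x - Gamma g m m k x) := by
    intro k
    rw [evalAt_smul, map_sub, Matrix.trace, Matrix.trace, map_sum, map_sum,
      ← Finset.sum_sub_distrib]
    congr 1
    refine Finset.sum_congr rfl fun m _ => ?_
    rw [Matrix.diag, Matrix.diag, hC, hC', evalAt_christoffel hV hgbar, evalAt_christoffel hV hg,
      hgbar.Gamma_symm hV x.2, hg.Gamma_symm hV x.2]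
  have hn : (n : ℝ) + 1 ≠ 0 := by positivity
  simp only [of_apply] at key
  simp only [map_apply, Matrix.add_apply, Matrix.smul_apply, map_add, smul_eq_mul, _root_.map_mul,
    vecMulVec_apply, hφ, one_apply, Pi.single_apply]
  rw [hC, hC', evalAt_christoffel hV hgbar, evalAt_christoffel hV hg, ← sub_eq_iff_eq_add']
  refine mul_left_cancel₀ hn (key.trans ?_)
  rw [mul_add, ← mul_assoc, ← mul_assoc]
  by_cases h1 : i = j <;> by_cases h2 : i = k <;> simp [h1, h2, hn]

theorem contDiffOn_conformalFactor {U : Set (Fin n → ℝ)}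
    {g gbar : (Fin n → ℝ) → Matrix (Fin n) (Fin n) ℝ}
    (hg : IsMetricOn U g) (hgbar : IsMetricOn U gbar) :
    ContDiffOn ℝ (⊤ : ℕ∞)
      (fun y => |(gbar y).det / (g y).det| ^ ((1 : ℝ) / ((n : ℝ) + 1))) U := by
  have hg0 : ∀ y ∈ U, (g y).det ≠ 0 := fun y hy => (hg.nondeg y hy).ne_zero
  have hb0 : ∀ y ∈ U, (gbar y).det ≠ 0 := fun y hy => (hgbar.nondeg y hy).ne_zero
  exact (((ContDiffOn.matrix_det hgbar.smooth).div (ContDiffOn.matrix_det hg.smooth) hg0).abs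
      fun y hy => div_ne_zero (hb0 y hy) (hg0 y hy)).rpow_const_of_ne
      fun y hy => abs_ne_zero.mpr (div_ne_zero (hb0 y hy) (hg0 y hy))

theorem _root_.IsMetricOn.mono {U V : Set (Fin n → ℝ)}
    {g : (Fin n → ℝ) → Matrix (Fin n) (Fin n) ℝ} (hg : IsMetricOn U g) (hVU : V ⊆ U) :
    IsMetricOn V g where
  smooth i j := (hg.smooth i j).mono hVU
  symm x hx := hg.symm x (hVU hx)
  nondeg x hx := hg.nondeg x (hVU hx)

theorem isLinearMap_assoc_left {ι R : Type*} [Fintype ι] [CommRing R] [Algebra ℝ R]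
    (d : ι → Derivation ℝ R R) (u' u f : R) :
    IsLinearMap ℝ fun M : Matrix ι ι R => assoc d u' u M f where
  map_add M N := by simp [assoc, mul_add, add_mul, Finset.sum_add_distrib]
  map_smul r M := by
    simp only [assoc, Matrix.smul_apply, smul_mul_assoc, mul_smul_comm, Derivation.map_smul,
      ← Finset.smul_sum]

theorem isLinearMap_assoc_right {ι R : Type*} [Fintype ι] [CommRing R] [Algebra ℝ R]
    (d : ι → Derivation ℝ R R) (u' u : R) (M : Matrix ι ι R) :
    IsLinearMap ℝ fun f : R => assoc d u' u M f where
  map_add f h := by simp [assoc, mul_add, Finset.sum_add_distrib]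
  map_smul r f := by
    simp only [assoc, mul_smul_comm, Derivation.map_smul, ← Finset.smul_sum]

theorem contDiffOn_Lfield {U : Set (Fin n → ℝ)} {g gbar : (Fin n → ℝ) → Matrix (Fin n) (Fin n) ℝ}
    (hg : IsMetricOn U g) (hgbar : IsMetricOn U gbar) (i j : Fin n) :
    ContDiffOn ℝ (⊤ : ℕ∞) (fun x => Lfield g gbar x i j) U := by
  simp only [Lfield, Matrix.smul_apply, mul_apply, smul_eq_mul]
  exact (contDiffOn_conformalFactor hg hgbar).mul (ContDiffOn.sum fun k _ =>
    (ContDiffOn.matrix_inv hgbar.smooth hgbar.nondeg i k).mul (hg.smooth k j))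

theorem exists_finset_det_ne_zero (M : Matrix (Fin n) (Fin n) ℝ) (N : ℕ) :
    ∃ s : Finset ℝ, (∀ τ ∈ s, (τ • (1 : Matrix (Fin n) (Fin n) ℝ) - M).det ≠ 0) ∧ s.card = N := by
  have hfin : {τ : ℝ | M.charpoly.IsRoot τ}.Finite :=
    Polynomial.finite_setOfPred_isRoot M.charpoly_monic.ne_zero
  obtain ⟨s, hs, hN⟩ := hfin.infinite_compl.exists_subset_card_eq N
  refine ⟨s, fun τ hτ h => hs hτ ?_, hN⟩
  rw [Set.mem_ofPred_eq, Polynomial.IsRoot, eval_charpoly, ← h, smul_one_eq_diagonal]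
  rfl

/-- The commutation relation near points where enough members of the pencil are invertible. -/
theorem commute_of_det_ne_zero {V : Set (Fin n → ℝ)} (hV : IsOpen V)
    {g gbar : (Fin n → ℝ) → Matrix (Fin n) (Fin n) ℝ}
    (hg : IsMetricOn V g) (hgbar : IsMetricOn V gbar)
    (hP : ∀ x ∈ V, ∀ v : Fin n → ℝ, ∃ c : ℝ, ∀ k, ∑ i, ∑ j,
      (Gamma gbar k i j x - Gamma g k i j x) * v i * v j = c * v k)
    {s : Finset ℝ} (hs : n < s.card)
    (hdet : ∀ τ ∈ s, ∀ y ∈ V, (τ • (1 : Matrix (Fin n) (Fin n) ℝ) - Lfield g gbar y).det ≠ 0)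
    (t : ℝ) {f : (Fin n → ℝ) → ℝ} (hf : ContDiffOn ℝ (⊤ : ℕ∞) f V) {x : Fin n → ℝ} (hx : x ∈ V) :
    LaplaceOp g (Khat g gbar t f) x = Khat g gbar t (LaplaceOp g f) x := by
  have hg0 : ∀ y ∈ V, (g y).det ≠ 0 := fun y hy => (hg.nondeg y hy).ne_zero
  have hpow : ∀ a : ℝ, ContDiffOn ℝ (⊤ : ℕ∞) (fun y => |(g y).det| ^ a) V := fun a =>
    ((ContDiffOn.matrix_det hg.smooth).abs hg0).rpow_const_of_ne
      fun y hy => abs_ne_zero.mpr (hg0 y hy)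
  set G := restrictMatrix g hg.smooth with hG
  set G' := restrictMatrix gbar hgbar.smooth with hG'
  set u' := restrict _ (hpow (-(1 : ℝ) / 2))
  set u := restrict _ (hpow ((1 : ℝ) / 2))
  set w := restrict _ (contDiffOn_conformalFactor hg hgbar)
  set d := pderiv hV
  have hGdet : IsUnit G.det := isUnit_det_of_evalAt fun y => hg.nondeg y y.2
  have hG'det : IsUnit G'.det := isUnit_det_of_evalAt fun y => hgbar.nondeg y y.2
  have hGs : G.IsSymm := matrix_ext_evalAt fun y => hg.symm y y.2
  have hG's : G'.IsSymm := matrix_ext_evalAt fun y => hgbar.symm y y.2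
  have hGinv : ∀ y, G⁻¹.map (evalAt y) = (g y)⁻¹ := map_evalAt_inv hGdet
  have hdetG : ∀ y, evalAt y G.det = (g y).det := fun y => RingHom.map_det _ _
  have hdetG' : ∀ y, evalAt y G'.det = (gbar y).det := fun y => RingHom.map_det _ _
  have hL : ∀ y, (w • (G'⁻¹ * G)).map (evalAt y) = Lfield g gbar y := by
    intro y
    ext i j
    have : evalAt y ((G'⁻¹ * G) i j) = ((gbar y)⁻¹ * g y) i j := by
      have := Matrix.map_mul (L := G'⁻¹) (M := G) (f := evalAt y)
      rw [map_evalAt_inv hG'det y] at this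
      exact congrFun (congrFun this i) j
    rw [map_apply, Matrix.smul_apply, smul_eq_mul, _root_.map_mul, this]
    rfl
  have hpencil : ∀ τ : ℝ, ∀ y,
      (τ • (1 : Matrix (Fin n) (Fin n) (smoothAlg V)) - w • (G'⁻¹ * G)).map (evalAt y) =
        τ • (1 : Matrix (Fin n) (Fin n) ℝ) - Lfield g gbar y := fun τ y => by
    rw [map_evalAt_smul_one_sub, hL]
  have hadj : ∀ τ : ℝ, ∀ y,
      (τ • (1 : Matrix (Fin n) (Fin n) (smoothAlg V)) - w • (G'⁻¹ * G)).adjugate.map (evalAt y) =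
        Sfield g gbar τ y := fun τ y => by
    rw [Sfield, ← hpencil]; exact RingHom.map_adjugate _ _
  set S : ℝ → Matrix (Fin n) (Fin n) (smoothAlg V) :=
    fun τ => (τ • (1 : Matrix (Fin n) (Fin n) (smoothAlg V)) - w • (G'⁻¹ * G)).adjugate with hS
  obtain ⟨φ, hφ⟩ := christoffel_sub_eq hV hg hgbar hP
  have huu : u' * u = 1 := by
    ext y
    change |(g y).det| ^ (-(1 : ℝ) / 2) * |(g y).det| ^ ((1 : ℝ) / 2) = 1
    rw [← Real.rpow_add (abs_pos.mpr (hg0 y y.2))]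
    norm_num
  have hu4 : u ^ 4 = G.det ^ 2 := by
    ext y
    change (|(g y).det| ^ ((1 : ℝ) / 2)) ^ 4 = evalAt y (G.det ^ 2)
    rw [map_pow, hdetG, ← sq_abs, ← Real.rpow_natCast, ← Real.rpow_mul (abs_nonneg _)]
    norm_num
  have hw2 : w ^ (2 * (Fintype.card (Fin n) + 1)) * G.det ^ 2 = G'.det ^ 2 := by
    ext y
    change (|(gbar y).det / (g y).det| ^ ((1 : ℝ) / ((n : ℝ) + 1))) ^
      (2 * (Fintype.card (Fin n) + 1)) * evalAt y (G.det ^ 2) = evalAt y (G'.det ^ 2)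
    have hn : (n : ℝ) + 1 ≠ 0 := by positivity
    have e : (1 : ℝ) / ((n : ℝ) + 1) * ((2 * (n + 1) : ℕ) : ℝ) = (2 : ℕ) := by
      push_cast; field_simp
    rw [map_pow, map_pow, hdetG, hdetG', Fintype.card_fin, ← Real.rpow_natCast,
      ← Real.rpow_mul (abs_nonneg _), e, Real.rpow_natCast, sq_abs, div_pow,
      div_mul_cancel₀ _ (pow_ne_zero 2 (hg0 y y.2))]
  have hcomm : ∀ τ ∈ s, ∀ F, assoc d u' u G⁻¹ (assoc d u' u (S τ * G⁻¹) F) =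
      assoc d u' u (S τ * G⁻¹) (assoc d u' u G⁻¹ F) := fun τ hτ F =>
    commute_of_projective (pderiv_comm hV) hGs hGdet hG's hG'det hφ huu hu4 hw2
      (isUnit_det_of_evalAt fun y => by
        rw [hpencil]; exact (hdet τ hτ y y.2).isUnit) F
  have hsum : S t = ∑ τ ∈ s, (Lagrange.basis s id τ).eval t • S τ := by
    refine matrix_ext_evalAt fun y => ?_
    rw [hadj, Sfield, adjugate_eq_sum s hs]
    ext i j
    simp only [Matrix.sum_apply, map_apply, map_sum, Matrix.smul_apply, evalAt_smul]
    exact Finset.sum_congr rfl fun τ _ => congrArg _ (congrFun (congrFun (hadj τ y) i) j).symm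
  have hassoc : ∀ F, assoc d u' u (S t * G⁻¹) F =
      ∑ τ ∈ s, (Lagrange.basis s id τ).eval t • assoc d u' u (S τ * G⁻¹) F := fun F => by
    rw [hsum, Finset.sum_mul]
    simp only [Matrix.smul_mul]
    have := isLinearMap_assoc_left d u' u F
    exact (map_sum (this.mk' _) _ _).trans (Finset.sum_congr rfl fun τ _ => this.map_smul _ _)
  have hcommt : ∀ F, assoc d u' u G⁻¹ (assoc d u' u (S t * G⁻¹) F) =
      assoc d u' u (S t * G⁻¹) (assoc d u' u G⁻¹ F) := fun F => by
    rw [hassoc, hassoc]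
    have := isLinearMap_assoc_right d u' u G⁻¹
    exact (map_sum (this.mk' _) _ _).trans (Finset.sum_congr rfl fun τ hτ =>
      (this.map_smul _ _).trans (by rw [hcomm τ hτ]))
  have hru' : Represents u' fun y => |(g y).det| ^ (-(1 : ℝ) / 2) := fun _ => rfl
  have hru : Represents u fun y => |(g y).det| ^ ((1 : ℝ) / 2) := fun _ => rfl
  have hΔ : ∀ {F h}, Represents F h → Represents (assoc d u' u G⁻¹ F) (LaplaceOp g h) :=
    fun hF => Represents.assoc hV hru' hru (fun i j y => congrFun (congrFun (hGinv y) i) j) hF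
  have hK : ∀ {F h}, Represents F h →
      Represents (assoc d u' u (S t * G⁻¹) F) (Khat g gbar t h) := fun hF =>
    Represents.assoc hV hru' hru (fun i j y => by
      have := Matrix.map_mul (L := S t) (M := G⁻¹) (f := evalAt y)
      rw [hGinv, hadj] at this
      exact congrFun (congrFun this i) j) hF
  have hF := represents_restrict f hf
  rw [← hΔ (hK hF) ⟨x, hx⟩, ← hK (hΔ hF) ⟨x, hx⟩, hcommt]

end Main

end DiffAlg

theorem Khat_commutes_with_Laplace {n : ℕ} (hn : 2 ≤ n) (U : Set (Fin n → ℝ)) (hUo : IsOpen U) (hUc : IsConnected U)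
    (g gbar : (Fin n → ℝ) → Matrix (Fin n) (Fin n) ℝ)
    (hg : IsMetricOn U g) (hgbar : IsMetricOn U gbar)
    (hproj : ProjEquiv U g gbar) (t : ℝ)
    (f : (Fin n → ℝ) → ℝ) (hf : ContDiffOn ℝ (⊤ : ℕ∞) f U) :
    ∀ x ∈ U, LaplaceOp g (Khat g gbar t f) x = Khat g gbar t (LaplaceOp g f) x := by
  intro x hx
  obtain ⟨s, hs, hcard⟩ := DiffAlg.exists_finset_det_ne_zero (Lfield g gbar x) (n + 1)
  have hcont : ContinuousOn
      (fun y => ∏ τ ∈ s, (τ • (1 : Matrix (Fin n) (Fin n) ℝ) - Lfield g gbar y).det) U :=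
    continuousOn_finsetProd _ fun τ _ => (ContDiffOn.matrix_det (m := (⊤ : ℕ∞)) fun i j =>
      contDiffOn_const.sub (DiffAlg.contDiffOn_Lfield hg hgbar i j)).continuousOn
  set V := U ∩ (fun y => ∏ τ ∈ s,
    (τ • (1 : Matrix (Fin n) (Fin n) ℝ) - Lfield g gbar y).det) ⁻¹' {0}ᶜ
  have hV : IsOpen V := hcont.isOpen_inter_preimage hUo isOpen_compl_singleton
  have hVU : V ⊆ U := Set.inter_subset_left
  exact DiffAlg.commute_of_det_ne_zero hV (hg.mono hVU) (hgbar.mono hVU)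
    (fun y hy => hproj.exists_Gamma_sub hUo hg (hVU hy)) (s := s) (by omega)
    (fun τ hτ y hy => Finset.prod_ne_zero_iff.mp hy.2 τ hτ) t (hf.mono hVU)
    ⟨hx, Finset.prod_ne_zero_iff.mpr hs⟩
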